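/- arXiv:2210.15054 — 8 statements merged into one kernel-verified Lean document; each statement's English description precedes it below -/
import Mathlib

section
/- For any smooth 2π-periodic functions Ψ₀, Ψ₁ : ℝ → ℝ, there exists a unique smooth function Ψ : ℝ × ℝ → ℝ which is 2π-periodic in its first (space) variable, satisfies the wave equation ∂²Ψ/∂t² (x,t) = ∂²Ψ/∂x² (x,t) for all (x,t) ∈ ℝ × ℝ, and satisfies the initial conditions Ψ(x,0) = Ψ₀(x) and (∂Ψ/∂t)(x,0) = Ψ₁(x) for all x ∈ ℝ. -/
open Real

/-- A differentiable function whose derivative vanishes in the direction `v` is constant along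
`v`. -/
lemma apply_add_smul_eq_of_fderiv_apply_eq_zero {E : Type*} [NormedAddCommGroup E]
    [NormedSpace ℝ E] {g : E → ℝ} (hg : Differentiable ℝ g) {v : E}
    (hv : ∀ p, fderiv ℝ g p v = 0) (p : E) (s : ℝ) : g (p + s • v) = g p := by
  have h : ∀ r : ℝ, HasDerivAt (fun r : ℝ => g (p + r • v)) 0 r := fun r => by
    have hline : HasDerivAt (fun r : ℝ => p + r • v) v r := by
      simpa using ((hasDerivAt_id r).smul_const v).const_add p
    simpa only [hv, Function.comp_def] using
      (hg (p + r • v)).hasFDerivAt.comp_hasDerivAt r hline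
  simpa using is_const_of_deriv_eq_zero (fun r => (h r).differentiableAt)
    (fun r => (h r).deriv) s 0

lemma hasDerivAt_comp_prodMk_right {g : ℝ × ℝ → ℝ} (hg : Differentiable ℝ g) (x t : ℝ) :
    HasDerivAt (fun s => g (x, s)) (fderiv ℝ g (x, t) (0, 1)) t :=
  (hg (x, t)).hasFDerivAt.comp_hasDerivAt t ((hasDerivAt_const t x).prodMk (hasDerivAt_id t))

lemma hasDerivAt_comp_prodMk_left {g : ℝ × ℝ → ℝ} (hg : Differentiable ℝ g) (x t : ℝ) :
    HasDerivAt (fun y => g (y, t)) (fderiv ℝ g (x, t) (1, 0)) x :=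
  (hg (x, t)).hasFDerivAt.comp_hasDerivAt x ((hasDerivAt_id x).prodMk (hasDerivAt_const x t))

lemma fderiv_fderiv_apply_const {u : ℝ × ℝ → ℝ} (hu : ContDiff ℝ (⊤ : ℕ∞) u)
    (a b p : ℝ × ℝ) :
    fderiv ℝ (fun q => fderiv ℝ u q a) p b = fderiv ℝ (fderiv ℝ u) p b a := by
  have h : Differentiable ℝ (fderiv ℝ u) :=
    (hu.fderiv_right (m := 1) (by norm_cast)).differentiable (by norm_num)
  rw [fderiv_clm_apply (h p) (differentiableAt_const a)]
  simp

/-- The time derivative of a smooth solution of the wave equation in terms of its initial data. -/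
lemma deriv_time_of_wave_equation {u : ℝ × ℝ → ℝ} {f g : ℝ → ℝ}
    (hu : ContDiff ℝ (⊤ : ℕ∞) u)
    (hwave : ∀ x t : ℝ,
      deriv (fun s => deriv (fun r => u (x, r)) s) t =
        deriv (fun y => deriv (fun z => u (z, t)) y) x)
    (h₀ : ∀ x : ℝ, u (x, 0) = f x)
    (h₁ : ∀ x : ℝ, deriv (fun s => u (x, s)) 0 = g x) (x t : ℝ) :
    deriv (fun s => u (x, s)) t =
      (g (x + t) + deriv f (x + t) + (g (x - t) - deriv f (x - t))) / 2 := by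
  have hud : Differentiable ℝ u := hu.differentiable (by simp)
  have hdir : ∀ a : ℝ × ℝ, Differentiable ℝ (fun q => fderiv ℝ u q a) := fun a =>
    ((hu.fderiv_right (m := 1) (by norm_cast)).clm_apply contDiff_const).differentiable
      (by norm_num)
  have hsymm : ∀ p a b, fderiv ℝ (fderiv ℝ u) p a b = fderiv ℝ (fderiv ℝ u) p b a :=
    fun p a b => hu.contDiffAt.isSymmSndFDerivAt (by simp; norm_cast) a b
  have ht : ∀ x t, deriv (fun s => u (x, s)) t = fderiv ℝ u (x, t) (0, 1) := fun x t =>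
    (hasDerivAt_comp_prodMk_right hud x t).deriv
  have hx : ∀ x t, deriv (fun y => u (y, t)) x = fderiv ℝ u (x, t) (1, 0) := fun x t =>
    (hasDerivAt_comp_prodMk_left hud x t).deriv
  have hw : ∀ p : ℝ × ℝ, fderiv ℝ (fderiv ℝ u) p (0, 1) (0, 1) =
      fderiv ℝ (fderiv ℝ u) p (1, 0) (1, 0) := by
    rintro ⟨x, t⟩
    have h := hwave x t
    simp only [ht, hx] at h
    rwa [(hasDerivAt_comp_prodMk_right (hdir (0, 1)) x t).deriv,
      (hasDerivAt_comp_prodMk_left (hdir (1, 0)) x t).deriv,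
      fderiv_fderiv_apply_const hu, fderiv_fderiv_apply_const hu] at h
  have hsplit : ∀ c : ℝ, ((c, 1) : ℝ × ℝ) = (0, 1) + c • (1, 0) := fun c => by simp
  have hchar : ∀ c : ℝ, c * c = 1 → ∀ p,
      fderiv ℝ (fun q => fderiv ℝ u q (c, 1)) p (-c, 1) = 0 := by
    intro c hc p
    rw [fderiv_fderiv_apply_const hu, hsplit c, hsplit (-c)]
    simp only [map_add, map_smul, add_apply, smul_apply, smul_eq_mul]
    rw [hw p, hsymm p (1, 0) (0, 1)]
    linear_combination (-fderiv ℝ (fderiv ℝ u) p (1, 0) (1, 0)) * hc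
  have hinit : ∀ c y, fderiv ℝ u (y, 0) (c, 1) = g y + c * deriv f y := by
    intro c y
    have hf : f = fun z => u (z, 0) := funext fun z => (h₀ z).symm
    rw [hsplit, map_add, map_smul, ← ht, h₁, ← hx, hf, smul_eq_mul]
  have htransport : ∀ c : ℝ, c * c = 1 →
      fderiv ℝ u (x, t) (c, 1) = g (x + c * t) + c * deriv f (x + c * t) := by
    intro c hc
    have h := apply_add_smul_eq_of_fderiv_apply_eq_zero (hdir (c, 1)) (hchar c hc) (x, t) (-t)
    rw [← h, ← hinit]
    congr 2
    ext <;> simp [mul_comm]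
  have hp := htransport 1 (by norm_num)
  have hm := htransport (-1) (by norm_num)
  rw [hsplit, map_add, map_smul, smul_eq_mul] at hp hm
  rw [ht]
  simp only [one_mul, neg_mul, ← sub_eq_add_neg] at hp hm
  linarith

lemma wave_equation_unique {u v : ℝ × ℝ → ℝ} {f g : ℝ → ℝ}
    (hu : ContDiff ℝ (⊤ : ℕ∞) u) (hv : ContDiff ℝ (⊤ : ℕ∞) v)
    (hu_wave : ∀ x t : ℝ,
      deriv (fun s => deriv (fun r => u (x, r)) s) t =
        deriv (fun y => deriv (fun z => u (z, t)) y) x)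
    (hv_wave : ∀ x t : ℝ,
      deriv (fun s => deriv (fun r => v (x, r)) s) t =
        deriv (fun y => deriv (fun z => v (z, t)) y) x)
    (hu₀ : ∀ x : ℝ, u (x, 0) = f x) (hv₀ : ∀ x : ℝ, v (x, 0) = f x)
    (hu₁ : ∀ x : ℝ, deriv (fun s => u (x, s)) 0 = g x)
    (hv₁ : ∀ x : ℝ, deriv (fun s => v (x, s)) 0 = g x) : u = v := by
  have hslice : ∀ {w : ℝ × ℝ → ℝ}, ContDiff ℝ (⊤ : ℕ∞) w → ∀ x,
      Differentiable ℝ fun s => w (x, s) := fun hw x t =>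
    (hasDerivAt_comp_prodMk_right (hw.differentiable (by simp)) x t).differentiableAt
  ext ⟨x, t⟩
  have h := is_const_of_deriv_eq_zero ((hslice hu x).sub (hslice hv x)) (fun s => by
    rw [deriv_sub (hslice hu x s) (hslice hv x s),
      deriv_time_of_wave_equation hu hu_wave hu₀ hu₁,
      deriv_time_of_wave_equation hv hv_wave hv₀ hv₁, sub_self]) t 0
  simp only [Pi.sub_apply, hu₀, hv₀, sub_self] at h
  exact sub_eq_zero.mp h

/-- A superposition of a left-moving and a right-moving wave solves the wave equation. -/
lemma wave_equation_of_travelling_waves {A B : ℝ → ℝ} (hA : ContDiff ℝ (⊤ : ℕ∞) A)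
    (hB : ContDiff ℝ (⊤ : ℕ∞) B) (x t : ℝ) :
    deriv (fun s => deriv (fun r => A (x + r) + B (x - r)) s) t =
      deriv (fun y => deriv (fun z => A (z + t) + B (z - t)) y) x := by
  have hA₁ : Differentiable ℝ A := hA.differentiable (by simp)
  have hB₁ : Differentiable ℝ B := hB.differentiable (by simp)
  have hA₂ : Differentiable ℝ (deriv A) :=
    (contDiff_infty_iff_deriv.mp hA).2.differentiable (by simp)
  have hB₂ : Differentiable ℝ (deriv B) :=
    (contDiff_infty_iff_deriv.mp hB).2.differentiable (by simp)
  have ht : (fun s => deriv (fun r => A (x + r) + B (x - r)) s) =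
      fun s => deriv A (x + s) - deriv B (x - s) := funext fun s =>
    (((hA₁ _).hasDerivAt.comp_const_add x s).fun_add
      ((hB₁ _).hasDerivAt.comp_const_sub x s)).deriv
  have hx : (fun y => deriv (fun z => A (z + t) + B (z - t)) y) =
      fun y => deriv A (y + t) + deriv B (y - t) := funext fun y =>
    (((hA₁ _).hasDerivAt.comp_add_const y t).fun_add
      ((hB₁ _).hasDerivAt.comp_sub_const y t)).deriv
  rw [ht, hx, (((hA₂ _).hasDerivAt.comp_const_add x t).fun_sub
      ((hB₂ _).hasDerivAt.comp_const_sub x t)).deriv,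
    (((hA₂ _).hasDerivAt.comp_add_const x t).fun_add
      ((hB₂ _).hasDerivAt.comp_sub_const x t)).deriv]
  ring

lemma exists_contDiff_antideriv {g : ℝ → ℝ} (hg : ContDiff ℝ (⊤ : ℕ∞) g) :
    ∃ G : ℝ → ℝ, ContDiff ℝ (⊤ : ℕ∞) G ∧ ∀ x, HasDerivAt G (g x) x := by
  have h : ∀ x, HasDerivAt (fun x => ∫ y in (0 : ℝ)..x, g y) (g x) x := fun x =>
    intervalIntegral.integral_hasDerivAt_right (hg.continuous.intervalIntegrable _ _)
      (hg.continuous.stronglyMeasurableAtFilter _ _) hg.continuous.continuousAt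
  refine ⟨_, contDiff_infty_iff_deriv.mpr ⟨fun x => (h x).differentiableAt, ?_⟩, h⟩
  rwa [funext fun x => (h x).deriv]

/-- existence and uniqueness of the smooth, space-periodic solution of the
wave equation `∂²Ψ/∂t² = ∂²Ψ/∂x²` with prescribed smooth periodic initial data. -/
theorem wave_equation_existence_uniqueness
    (Ψ₀ Ψ₁ : ℝ → ℝ)
    (hΨ₀ : ContDiff ℝ (⊤ : ℕ∞) Ψ₀) (hΨ₁ : ContDiff ℝ (⊤ : ℕ∞) Ψ₁)
    (hper₀ : ∀ x : ℝ, Ψ₀ (x + 2 * π) = Ψ₀ x)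
    (hper₁ : ∀ x : ℝ, Ψ₁ (x + 2 * π) = Ψ₁ x) :
    ∃! Ψ : ℝ × ℝ → ℝ,
      ContDiff ℝ (⊤ : ℕ∞) Ψ ∧
      (∀ x t : ℝ, Ψ (x + 2 * π, t) = Ψ (x, t)) ∧
      (∀ x t : ℝ,
        deriv (fun s => deriv (fun u => Ψ (x, u)) s) t =
          deriv (fun y => deriv (fun z => Ψ (z, t)) y) x) ∧
      (∀ x : ℝ, Ψ (x, 0) = Ψ₀ x) ∧
      (∀ x : ℝ, deriv (fun s => Ψ (x, s)) 0 = Ψ₁ x) := by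
  obtain ⟨G, hG, hG'⟩ := exists_contDiff_antideriv hΨ₁
  have hperG : ∀ x y : ℝ, G (x + 2 * π) - G x = G (y + 2 * π) - G y := fun x y => by
    have h : ∀ z, HasDerivAt (fun z => G (z + 2 * π) - G z) 0 z := fun z => by
      simpa [hper₁] using ((hG' (z + 2 * π)).comp_add_const z (2 * π)).fun_sub (hG' z)
    exact is_const_of_deriv_eq_zero (fun z => (h z).differentiableAt)
      (fun z => (h z).deriv) x y
  let A : ℝ → ℝ := fun y => (Ψ₀ y + G y) / 2
  let B : ℝ → ℝ := fun y => (Ψ₀ y - G y) / 2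
  have hA : ContDiff ℝ (⊤ : ℕ∞) A := (hΨ₀.add hG).div_const 2
  have hB : ContDiff ℝ (⊤ : ℕ∞) B := (hΨ₀.sub hG).div_const 2
  have hΨ : ContDiff ℝ (⊤ : ℕ∞) fun p : ℝ × ℝ => A (p.1 + p.2) + B (p.1 - p.2) :=
    (hA.comp (contDiff_fst.add contDiff_snd)).add (hB.comp (contDiff_fst.sub contDiff_snd))
  have h₀ : ∀ x : ℝ, A (x + 0) + B (x - 0) = Ψ₀ x := fun x => by
    simp only [A, B, add_zero, sub_zero]
    ring
  have h₁ : ∀ x : ℝ, deriv (fun s => A (x + s) + B (x - s)) 0 = Ψ₁ x := fun x => by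
    have hΨ₀' : ∀ y, HasDerivAt Ψ₀ (deriv Ψ₀ y) y := fun y =>
      (hΨ₀.differentiable (by simp) y).hasDerivAt
    have hA' : ∀ y, HasDerivAt A ((deriv Ψ₀ y + Ψ₁ y) / 2) y := fun y =>
      ((hΨ₀' y).add (hG' y)).div_const 2
    have hB' : ∀ y, HasDerivAt B ((deriv Ψ₀ y - Ψ₁ y) / 2) y := fun y =>
      ((hΨ₀' y).sub (hG' y)).div_const 2
    rw [(((hA' _).comp_const_add x 0).fun_add ((hB' _).comp_const_sub x 0)).deriv, add_zero,
      sub_zero]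
    ring
  refine ⟨fun p => A (p.1 + p.2) + B (p.1 - p.2),
    ⟨hΨ, fun x t => ?_, wave_equation_of_travelling_waves hA hB, h₀, h₁⟩, ?_⟩
  · have h := hperG (x + t) (x - t)
    simp only [A, B, add_right_comm x _ t, add_sub_right_comm x _ t, hper₀]
    linarith
  · rintro u ⟨hu, -, hu_wave, hu₀, hu₁⟩
    exact wave_equation_unique hu hΨ hu_wave (wave_equation_of_travelling_waves hA hB)
      hu₀ h₀ hu₁ h₁
end

section
/- Let Ψ₀, Ψ₁ : ℝ → ℝ be smooth, 2π-periodic and even (symmetric), and let ρ : ℝ × ℝ → ℝ be the smooth solution, 2π-periodic in x, of ∂²ρ/∂t² = ∂²ρ/∂x² with ρ(x,0) = Ψ₀(x), (∂ρ/∂t)(x,0) = Ψ₁(x). Define J(x,t) = ∫_{-π}^{x} −(∂ρ/∂t)(y,t) dy. Then: (i) (∂J/∂t)(x,t) = −(∂ρ/∂x)(x,t) for all (x,t); (ii) J itself satisfies the wave equation ∂²J/∂t² = ∂²J/∂x²; and (iii) for all (x,t), ρ(x,t) = a₀ + a₀′t + 2Σ_{m≥1} a_m cos(mx)cos(mt)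 + 2Σ_{m≥1}(a′_m/m)cos(mx)sin(mt) and J(x,t) = −a₀′π − a₀′x + 2Σ_{m≥1} a_m sin(mx)sin(mt) − 2Σ_{m≥1}(a′_m/m)sin(mx)cos(mt). -/
open Real

/-- Fourier cosine coefficient `a_m(f) = (1/2π) ∫_{-π}^{π} f(x) cos(mx) dx`. -/
noncomputable def fourierCosCoeff (f : ℝ → ℝ) (m : ℕ) : ℝ :=
  (1 / (2 * π)) * ∫ x in (-π)..π, f x * Real.cos (m * x)

theorem fderiv_wave_const_on_characteristic {ρ : ℝ × ℝ → ℝ} (hρ : ContDiff ℝ 2 ρ)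
    (hwave : ∀ x t : ℝ, deriv (fun s => deriv (fun u => ρ (x, u)) s) t =
      deriv (fun y => deriv (fun z => ρ (z, t)) y) x)
    {e : ℝ} (he : e * e = 1) (x t : ℝ) :
    fderiv ℝ ρ (x, t) (e, 1) = fderiv ℝ ρ (x + e * t, 0) (e, 1) := by
  have hd : Differentiable ℝ ρ := hρ.differentiable (by norm_num)
  have hd' : Differentiable ℝ (fderiv ℝ ρ) :=
    (hρ.fderiv_right (m := 1) (by norm_num)).differentiable (by norm_num)
  have h2 (x t : ℝ) : HasDerivAt (fun s : ℝ => (x, s)) ((0, 1) : ℝ × ℝ) t :=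
    (hasDerivAt_const t x).prodMk (hasDerivAt_id t)
  have h1 (x t : ℝ) : HasDerivAt (fun s : ℝ => (s, t)) ((1, 0) : ℝ × ℝ) x :=
    (hasDerivAt_id x).prodMk (hasDerivAt_const x t)
  have ht (x t : ℝ) : deriv (fun s => ρ (x, s)) t = fderiv ℝ ρ (x, t) (0, 1) :=
    ((hd (x, t)).hasFDerivAt.comp_hasDerivAt t (h2 x t)).deriv
  have hx (x t : ℝ) : deriv (fun s => ρ (s, t)) x = fderiv ℝ ρ (x, t) (1, 0) :=
    ((hd (x, t)).hasFDerivAt.comp_hasDerivAt x (h1 x t)).deriv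
  have hd2 {γ : ℝ → ℝ × ℝ} {v : ℝ × ℝ} {s : ℝ} (hγ : HasDerivAt γ v s) (w : ℝ × ℝ) :
      HasDerivAt (fun s => fderiv ℝ ρ (γ s) w) (fderiv ℝ (fderiv ℝ ρ) (γ s) v w) s := by
    have h : HasDerivAt (fun s => fderiv ℝ ρ (γ s)) (fderiv ℝ (fderiv ℝ ρ) (γ s) v) s :=
      (hd' (γ s)).hasFDerivAt.comp_hasDerivAt s hγ
    simpa using h.clm_apply (hasDerivAt_const s w)
  have hw (x t : ℝ) : fderiv ℝ (fderiv ℝ ρ) (x, t) (0, 1) (0, 1) =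
      fderiv ℝ (fderiv ℝ ρ) (x, t) (1, 0) (1, 0) := by
    have h := hwave x t
    simp only [ht, hx] at h
    rwa [(hd2 (h2 x t) _).deriv, (hd2 (h1 x t) _).deriv] at h
  have hsymm (p : ℝ × ℝ) : fderiv ℝ (fderiv ℝ ρ) p (0, 1) (1, 0) =
      fderiv ℝ (fderiv ℝ ρ) p (1, 0) (0, 1) :=
    (hρ.contDiffAt.isSymmSndFDerivAt (by simp)).eq _ _
  have hγ (s : ℝ) : HasDerivAt (fun s : ℝ => (x + e * t - e * s, s)) ((-e, 1) : ℝ × ℝ) s := by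
    refine HasDerivAt.prodMk ?_ (hasDerivAt_id s)
    simpa using ((hasDerivAt_id s).const_mul e).const_sub (x + e * t)
  have hderiv (s : ℝ) :
      HasDerivAt (fun s : ℝ => fderiv ℝ ρ (x + e * t - e * s, s) (e, 1)) 0 s := by
    refine (hd2 (hγ s) (e, 1)).congr_deriv ?_
    have hu : ((-e, 1) : ℝ × ℝ) = (-e) • (1, 0) + (0, 1) := by simp
    have hv : ((e, 1) : ℝ × ℝ) = e • (1, 0) + (0, 1) := by simp
    rw [hu, hv]
    simp only [map_add, map_smul, add_apply, smul_apply, hsymm, hw, smul_eq_mul]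
    linear_combination (-fderiv ℝ (fderiv ℝ ρ) (x + e * t - e * s, s) (1, 0) (1, 0)) * he
  have := is_const_of_deriv_eq_zero (fun s => (hderiv s).differentiableAt)
    (fun s => (hderiv s).deriv) t 0
  simpa using this

theorem deriv_wave_time {ρ : ℝ × ℝ → ℝ} (hρ : ContDiff ℝ 2 ρ)
    (hwave : ∀ x t : ℝ, deriv (fun s => deriv (fun u => ρ (x, u)) s) t =
      deriv (fun y => deriv (fun z => ρ (z, t)) y) x) (x t : ℝ) :
    HasDerivAt (fun s => ρ (x, s))
      ((deriv (fun s => ρ (x + t, s)) 0 + deriv (fun s => ρ (x - t, s)) 0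
        + deriv (fun y => ρ (y, 0)) (x + t) - deriv (fun y => ρ (y, 0)) (x - t)) / 2) t := by
  have hd : Differentiable ℝ ρ := hρ.differentiable (by norm_num)
  have ht (x t : ℝ) : HasDerivAt (fun s => ρ (x, s)) (fderiv ℝ ρ (x, t) (0, 1)) t :=
    (hd (x, t)).hasFDerivAt.comp_hasDerivAt t
      ((hasDerivAt_const t x).prodMk (hasDerivAt_id t))
  have hx (x t : ℝ) : HasDerivAt (fun s => ρ (s, t)) (fderiv ℝ ρ (x, t) (1, 0)) x :=
    (hd (x, t)).hasFDerivAt.comp_hasDerivAt x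
      ((hasDerivAt_id x).prodMk (hasDerivAt_const x t))
  refine (ht x t).congr_deriv ?_
  rw [(ht _ _).deriv, (ht _ _).deriv, (hx _ _).deriv, (hx _ _).deriv]
  have hp := fderiv_wave_const_on_characteristic hρ hwave (e := 1) (by norm_num) x t
  have hm := fderiv_wave_const_on_characteristic hρ hwave (e := -1) (by norm_num) x t
  have hv (e : ℝ) : ((e, 1) : ℝ × ℝ) = e • (1, 0) + (0, 1) := by simp
  rw [hv] at hp hm
  simp only [map_add, map_smul, smul_eq_mul, one_mul, neg_mul, ← sub_eq_add_neg] at hp hm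
  linarith

theorem hasDerivAt_traveling_time {A B A' B' : ℝ → ℝ} (hA : ∀ y, HasDerivAt A (A' y) y)
    (hB : ∀ y, HasDerivAt B (B' y) y) (c x t : ℝ) :
    HasDerivAt (fun s => A (x + s) + B (x - s) + c) (A' (x + t) - B' (x - t)) t := by
  have h1 := (hA (x + t)).comp_const_add x t
  have h2 := (hB (x - t)).comp_const_sub x t
  simpa [sub_eq_add_neg] using (h1.add h2).add_const c

theorem hasDerivAt_traveling_space {A B A' B' : ℝ → ℝ} (hA : ∀ y, HasDerivAt A (A' y) y)
    (hB : ∀ y, HasDerivAt B (B' y) y) (c x t : ℝ) :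
    HasDerivAt (fun y => A (y + t) + B (y - t) + c) (A' (x + t) + B' (x - t)) x :=
  (((hA (x + t)).comp_add_const x t).add ((hB (x - t)).comp_sub_const x t)).add_const c

/-- The traveling-wave representation of a solution of the wave equation on the line. -/
theorem wave_eq_traveling {ρ : ℝ × ℝ → ℝ} (hρ : ContDiff ℝ 2 ρ)
    (hwave : ∀ x t : ℝ, deriv (fun s => deriv (fun u => ρ (x, u)) s) t =
      deriv (fun y => deriv (fun z => ρ (z, t)) y) x)
    {P : ℝ → ℝ} (hP : ∀ x, HasDerivAt P (deriv (fun s => ρ (x, s)) 0) x) (x t : ℝ) :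
    ρ (x, t) = (ρ (x + t, 0) + P (x + t)) / 2 + (ρ (x - t, 0) - P (x - t)) / 2 := by
  have hd : Differentiable ℝ ρ := hρ.differentiable (by norm_num)
  have h0 (y : ℝ) : HasDerivAt (fun y => ρ (y, 0)) (deriv (fun y => ρ (y, 0)) y) y :=
    (hd.comp (by fun_prop : Differentiable ℝ fun y : ℝ => (y, (0 : ℝ)))).differentiableAt.hasDerivAt
  have h (s : ℝ) := (deriv_wave_time hρ hwave x s).sub
    (hasDerivAt_traveling_time (fun y => ((h0 y).add (hP y)).div_const 2)
      (fun y => ((h0 y).sub (hP y)).div_const 2) 0 x s)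
  have := is_const_of_deriv_eq_zero (fun s => (h s).differentiableAt)
    (fun s => (h s).deriv.trans (by ring)) t 0
  simp only [Pi.sub_apply, Pi.add_apply, add_zero, sub_zero] at this
  linarith

theorem fourierCosCoeff_deriv_deriv {f : ℝ → ℝ} (hf : ContDiff ℝ 2 f)
    (hper : Function.Periodic f (2 * π)) (m : ℕ) :
    fourierCosCoeff (deriv (deriv f)) m = -(m : ℝ) ^ 2 * fourierCosCoeff f m := by
  have hf' : ContDiff ℝ 1 (deriv f) := (contDiff_succ_iff_deriv (n := 1)).1 hf |>.2.2
  have hf'' : Continuous (deriv (deriv f)) := hf'.continuous_deriv le_rfl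
  have hfc := hf.continuous
  have hper' : deriv f (-π) = deriv f π := by
    have h : deriv (fun x => f (x + 2 * π)) (-π) = deriv f (-π) := by simp_rw [hper _]
    rw [deriv_comp_add_const] at h
    rw [← h]
    ring_nf
  have hderiv (x : ℝ) : HasDerivAt (fun x => deriv f x * cos (m * x) + m * (f x * sin (m * x)))
      (deriv (deriv f) x * cos (m * x) + m ^ 2 * (f x * cos (m * x))) x := by
    have hm : HasDerivAt (fun x : ℝ => (m : ℝ) * x) m x := by
      simpa using (hasDerivAt_id x).const_mul (m : ℝ)
    have h0 := ((hf.differentiable (by norm_num)) x).hasDerivAt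
    have h1 := ((hf'.differentiable (by norm_num)) x).hasDerivAt
    exact ((h1.mul hm.cos).add ((h0.mul hm.sin).const_mul (m : ℝ))).congr_deriv (by ring)
  have h := intervalIntegral.integral_eq_sub_of_hasDerivAt (a := -π) (b := π)
    (fun x _ => hderiv x) (Continuous.intervalIntegrable (by fun_prop) _ _)
  rw [intervalIntegral.integral_add (Continuous.intervalIntegrable (by fun_prop) _ _)
    (Continuous.intervalIntegrable (by fun_prop) _ _), intervalIntegral.integral_const_mul] at h
  simp only [mul_neg, cos_neg, sin_neg, sin_nat_mul_pi, hper', neg_zero, mul_zero, sub_self] at h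
  unfold fourierCosCoeff
  linear_combination (1 / (2 * π)) * h

theorem exists_abs_fourierCosCoeff_le {f : ℝ → ℝ} (hf : Continuous f) :
    ∃ M, ∀ m, |fourierCosCoeff f m| ≤ M := by
  obtain ⟨M, hM⟩ := (isCompact_uIcc (a := -π) (b := π)).exists_bound_of_continuousOn hf.continuousOn
  refine ⟨|1 / (2 * π)| * (M * |π - -π|), fun m => ?_⟩
  rw [fourierCosCoeff, abs_mul]
  gcongr
  refine intervalIntegral.norm_integral_le_of_norm_le_const (f := fun x => f x * cos (m * x))
    fun x hx => ?_
  rw [norm_mul]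
  exact (mul_le_of_le_one_right (norm_nonneg _) (abs_cos_le_one _)).trans
    (hM x (Set.uIoc_subset_uIcc hx))

theorem summable_abs_fourierCosCoeff {f : ℝ → ℝ} (hf : ContDiff ℝ 2 f)
    (hper : Function.Periodic f (2 * π)) : Summable fun m => |fourierCosCoeff f m| := by
  have hf' : ContDiff ℝ 1 (deriv f) := (contDiff_succ_iff_deriv (n := 1)).1 hf |>.2.2
  obtain ⟨M, hM⟩ := exists_abs_fourierCosCoeff_le (hf'.continuous_deriv le_rfl)
  rw [← summable_nat_add_iff 1]
  refine Summable.of_nonneg_of_le (fun _ => abs_nonneg _) (fun m => ?_)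
    (((summable_nat_add_iff 1).2 (Real.summable_one_div_nat_pow.2 one_lt_two)).mul_left M)
  have h := hM (m + 1)
  rw [fourierCosCoeff_deriv_deriv hf hper, abs_mul, abs_neg, abs_of_nonneg (sq_nonneg _)] at h
  rw [mul_one_div, le_div_iff₀ (by positivity)]
  linarith

theorem integral_mul_sin_eq_zero_of_even {f : ℝ → ℝ} (heven : ∀ x, f (-x) = f x) (c a : ℝ) :
    ∫ x in (-a)..a, f x * sin (c * x) = 0 := by
  have h := intervalIntegral.integral_comp_neg (a := -a) (b := a) (fun x => f x * sin (c * x))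
  simp only [heven, mul_neg, sin_neg, intervalIntegral.integral_neg, neg_neg] at h
  linarith

theorem hasSum_fourierCosCoeff {f : ℝ → ℝ} (hf : ContDiff ℝ 2 f)
    (hper : Function.Periodic f (2 * π)) (heven : ∀ x, f (-x) = f x) (x : ℝ) :
    HasSum (fun m : ℕ => fourierCosCoeff f (m + 1) * cos (((m : ℝ) + 1) * x))
      ((f x - fourierCosCoeff f 0) / 2) := by
  have : Fact (0 < 2 * π) := ⟨two_pi_pos⟩
  have hfc := hf.continuous
  have hperC : Function.Periodic (fun y => (f y : ℂ)) (2 * π) := fun y => by simp [hper y]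
  let F : C(AddCircle (2 * π), ℂ) :=
    ⟨hperC.lift, continuous_coinduced_dom.2 (by
      change Continuous fun y => (f y : ℂ)
      fun_prop)⟩
  have hF (y : ℝ) : F (y : AddCircle (2 * π)) = f y := rfl
  have hexp (n : ℤ) (y : ℝ) : fourier n (y : AddCircle (2 * π)) =
      Complex.exp (((n * y : ℝ) : ℂ) * Complex.I) := by
    rw [fourier_coe_apply]
    congr 1
    push_cast
    field_simp
  have hcoeff (n : ℤ) : fourierCoeff F n = (fourierCosCoeff f n.natAbs : ℂ) := by
    have hint : ∫ y in (-π)..π, fourier (-n) (y : AddCircle (2 * π)) • F y =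
        ((∫ y in (-π)..π, f y * cos (n.natAbs * y) : ℝ) : ℂ) := by
      have hcos (y : ℝ) : cos (n.natAbs * y) = cos (n * y) := by
        rw [Nat.cast_natAbs, Int.cast_abs]
        rcases abs_choice (n : ℝ) with h | h <;> simp [h]
      have hs := integral_mul_sin_eq_zero_of_even heven (n : ℝ) π
      simp_rw [hcos]
      have hsplit (y : ℝ) : fourier (-n) (y : AddCircle (2 * π)) • F y =
          ((f y * cos (n * y) : ℝ) : ℂ) - ((f y * sin (n * y) : ℝ) : ℂ) * Complex.I := by
        rw [hexp, hF, Complex.exp_mul_I, ← Complex.ofReal_cos, ← Complex.ofReal_sin]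
        push_cast
        simp only [neg_mul, Complex.cos_neg, Complex.sin_neg, smul_eq_mul]
        ring
      simp_rw [hsplit]
      rw [intervalIntegral.integral_sub (Continuous.intervalIntegrable (by fun_prop) _ _)
        (Continuous.intervalIntegrable (by fun_prop) _ _), intervalIntegral.integral_mul_const,
        intervalIntegral.integral_ofReal, intervalIntegral.integral_ofReal, hs]
      simp
    rw [fourierCoeff_eq_intervalIntegral _ _ (-π), show -π + 2 * π = π by ring, hint,
      fourierCosCoeff, Complex.real_smul, ← Complex.ofReal_mul]
  have hsum : Summable (fourierCoeff F) := by
    have h : Summable fun m : ℕ => (fourierCosCoeff f m : ℂ) :=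
      Complex.summable_ofReal.2 (summable_abs_fourierCosCoeff hf hper).of_abs
    exact Summable.of_nat_of_neg (by simpa [hcoeff] using h) (by simpa [hcoeff] using h)
  have h := (has_pointwise_sum_fourier_series_of_summable hsum (x : AddCircle (2 * π))).nat_add_neg
  have hterm (m : ℕ) : fourierCoeff F m • fourier (m : ℤ) (x : AddCircle (2 * π)) +
      fourierCoeff F (-m) • fourier (-m : ℤ) (x : AddCircle (2 * π)) =
      ((2 * (fourierCosCoeff f m * cos (m * x)) : ℝ) : ℂ) := by
    simp only [hcoeff, hexp, Complex.exp_mul_I, smul_eq_mul, Int.natAbs_neg, Int.natAbs_natCast]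
    push_cast
    simp only [neg_mul, Complex.cos_neg, Complex.sin_neg]
    ring
  simp_rw [hterm] at h
  have h0 : F (x : AddCircle (2 * π)) + fourierCoeff F 0 • fourier 0 (x : AddCircle (2 * π)) =
      ((f x + fourierCosCoeff f 0 : ℝ) : ℂ) := by
    simp [hcoeff, hF]
  rw [h0, Complex.hasSum_ofReal] at h
  have h' := ((hasSum_nat_add_iff' 1).2 h).div_const 2
  convert! h' using 1
  · ext m
    push_cast
    ring
  · simp
    ring

theorem hasSum_fourierCosCoeff_primitive {f : ℝ → ℝ} (hf : ContDiff ℝ 2 f)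
    (hper : Function.Periodic f (2 * π)) (heven : ∀ x, f (-x) = f x) (x : ℝ) :
    HasSum (fun m : ℕ => fourierCosCoeff f (m + 1) / ((m : ℝ) + 1) * sin (((m : ℝ) + 1) * x))
      (((∫ y in (0 : ℝ)..x, f y) - fourierCosCoeff f 0 * x) / 2) := by
  have hfc := hf.continuous
  have hbound : Summable fun m => |fourierCosCoeff f (m + 1)| :=
    (summable_nat_add_iff 1).2 (summable_abs_fourierCosCoeff hf hper)
  have h := intervalIntegral.hasSum_integral_of_dominated_convergence (a := 0) (b := x)
    (μ := MeasureTheory.volume)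
    (F := fun (m : ℕ) y => fourierCosCoeff f (m + 1) * cos (((m : ℝ) + 1) * y))
    (f := fun y => (f y - fourierCosCoeff f 0) / 2)
    (fun m _ => |fourierCosCoeff f (m + 1)|)
    (fun m => (by fun_prop : Continuous _).aestronglyMeasurable)
    (fun m => .of_forall fun y _ => by
      rw [norm_mul]
      exact mul_le_of_le_one_right (norm_nonneg _) (abs_cos_le_one _))
    (.of_forall fun y _ => hbound)
    (Continuous.intervalIntegrable (by fun_prop) _ _)
    (.of_forall fun y _ => hasSum_fourierCosCoeff hf hper heven y)
  convert! h using 1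
  · ext m
    have hm : (m : ℝ) + 1 ≠ 0 := by positivity
    rw [intervalIntegral.integral_const_mul, intervalIntegral.integral_comp_mul_left _ hm,
      integral_cos]
    simp
    field_simp
  · rw [intervalIntegral.integral_div, intervalIntegral.integral_sub
      (Continuous.intervalIntegrable (by fun_prop) _ _)
      (Continuous.intervalIntegrable (by fun_prop) _ _), intervalIntegral.integral_const]
    simp
    ring

/-- for even smooth periodic initial data, with `ρ` the smooth
space-periodic solution of the wave equation and `J(x,t) = ∫_{-π}^{x} -(∂ρ/∂t)(y,t) dy`,
one has `∂J/∂t = -∂ρ/∂x`, `J` satisfies the wave equation, and `ρ`, `J` are given by the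
stated convergent cosine/sine series. -/
theorem symmetric_wave_solution_current
    (Ψ₀ Ψ₁ : ℝ → ℝ)
    (hΨ₀ : ContDiff ℝ (⊤ : ℕ∞) Ψ₀) (hΨ₁ : ContDiff ℝ (⊤ : ℕ∞) Ψ₁)
    (hper₀ : ∀ x : ℝ, Ψ₀ (x + 2 * π) = Ψ₀ x)
    (hper₁ : ∀ x : ℝ, Ψ₁ (x + 2 * π) = Ψ₁ x)
    (heven₀ : ∀ x : ℝ, Ψ₀ (-x) = Ψ₀ x)
    (heven₁ : ∀ x : ℝ, Ψ₁ (-x) = Ψ₁ x)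
    (ρ : ℝ × ℝ → ℝ)
    (hρ : ContDiff ℝ (⊤ : ℕ∞) ρ)
    (hper : ∀ x t : ℝ, ρ (x + 2 * π, t) = ρ (x, t))
    (hwave : ∀ x t : ℝ,
      deriv (fun s => deriv (fun u => ρ (x, u)) s) t =
        deriv (fun y => deriv (fun z => ρ (z, t)) y) x)
    (hic₀ : ∀ x : ℝ, ρ (x, 0) = Ψ₀ x)
    (hic₁ : ∀ x : ℝ, deriv (fun s => ρ (x, s)) 0 = Ψ₁ x) :
    let J : ℝ × ℝ → ℝ := fun q => ∫ y in (-π)..q.1, -(deriv (fun s => ρ (y, s)) q.2)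
    -- (i) ∂J/∂t = -∂ρ/∂x
    (∀ x t : ℝ, deriv (fun s => J (x, s)) t = -(deriv (fun y => ρ (y, t)) x)) ∧
    -- (ii) J satisfies the wave equation
    (∀ x t : ℝ,
      deriv (fun s => deriv (fun u => J (x, u)) s) t =
        deriv (fun y => deriv (fun z => J (z, t)) y) x) ∧
    -- (iii) the explicit series for ρ and J
    (∀ x t : ℝ,
      (∃ S : ℝ,
        HasSum (fun m : ℕ =>
          fourierCosCoeff Ψ₀ (m + 1) * Real.cos (((m : ℝ) + 1) * x) * Real.cos (((m : ℝ) + 1) * t)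
          + (fourierCosCoeff Ψ₁ (m + 1) / ((m : ℝ) + 1)) * Real.cos (((m : ℝ) + 1) * x)
              * Real.sin (((m : ℝ) + 1) * t)) S ∧
        ρ (x, t) = fourierCosCoeff Ψ₀ 0 + fourierCosCoeff Ψ₁ 0 * t + 2 * S) ∧
      (∃ S' : ℝ,
        HasSum (fun m : ℕ =>
          fourierCosCoeff Ψ₀ (m + 1) * Real.sin (((m : ℝ) + 1) * x) * Real.sin (((m : ℝ) + 1) * t)
          - (fourierCosCoeff Ψ₁ (m + 1) / ((m : ℝ) + 1)) * Real.sin (((m : ℝ) + 1) * x)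
              * Real.cos (((m : ℝ) + 1) * t)) S' ∧
        J (x, t) = -(fourierCosCoeff Ψ₁ 0) * π - fourierCosCoeff Ψ₁ 0 * x + 2 * S')) := by
  intro J
  have h0 : ContDiff ℝ 2 Ψ₀ := contDiff_infty.1 hΨ₀ 2
  have h1 : ContDiff ℝ 2 Ψ₁ := contDiff_infty.1 hΨ₁ 2
  have h2 : ContDiff ℝ 2 ρ := contDiff_infty.1 hρ 2
  have h0' : ContDiff ℝ 1 (deriv Ψ₀) := (contDiff_succ_iff_deriv (n := 1)).1 h0 |>.2.2
  have hc1 := h1.continuous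
  have hc0' := h0'.continuous
  set P : ℝ → ℝ := fun x => ∫ y in (0 : ℝ)..x, Ψ₁ y with hPdef
  have hP (x : ℝ) : HasDerivAt P (Ψ₁ x) x := hc1.integral_hasStrictDerivAt 0 x |>.hasDerivAt
  have hd0 (x : ℝ) : HasDerivAt Ψ₀ (deriv Ψ₀ x) x :=
    (h0.differentiable (by norm_num) x).hasDerivAt
  have hd0' (x : ℝ) : HasDerivAt (deriv Ψ₀) (deriv (deriv Ψ₀) x) x :=
    (h0'.differentiable (by norm_num) x).hasDerivAt
  have hd1 (x : ℝ) : HasDerivAt Ψ₁ (deriv Ψ₁ x) x :=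
    (h1.differentiable (by norm_num) x).hasDerivAt
  set A : ℝ → ℝ := fun x => (Ψ₀ x + P x) / 2 with hAdef
  set B : ℝ → ℝ := fun x => (Ψ₀ x - P x) / 2 with hBdef
  set A' : ℝ → ℝ := fun x => (deriv Ψ₀ x + Ψ₁ x) / 2
  set B' : ℝ → ℝ := fun x => (deriv Ψ₀ x - Ψ₁ x) / 2
  have hA (x : ℝ) : HasDerivAt A (A' x) x := ((hd0 x).add (hP x)).div_const 2
  have hB (x : ℝ) : HasDerivAt B (B' x) x := ((hd0 x).sub (hP x)).div_const 2
  have hA' (x : ℝ) : HasDerivAt A' ((deriv (deriv Ψ₀) x + deriv Ψ₁ x) / 2) x :=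
    ((hd0' x).add (hd1 x)).div_const 2
  have hB' (x : ℝ) : HasDerivAt B' ((deriv (deriv Ψ₀) x - deriv Ψ₁ x) / 2) x :=
    ((hd0' x).sub (hd1 x)).div_const 2
  have hA'c : Continuous A' := by fun_prop
  have hB'c : Continuous B' := by fun_prop
  have hρAB (x t : ℝ) : ρ (x, t) = A (x + t) + B (x - t) + 0 := by
    rw [wave_eq_traveling h2 hwave (P := P) (by simpa only [hic₁] using hP), hic₀, hic₀, add_zero]
  have hseries0 := hasSum_fourierCosCoeff h0 hper₀ heven₀
  have hseries1 := hasSum_fourierCosCoeff_primitive h1 hper₁ heven₁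
  have hbdry (t : ℝ) : A (-π + t) - B (-π - t) = -(fourierCosCoeff Ψ₁ 0 * π) := by
    have hΨ : Ψ₀ (-π + t) = Ψ₀ (-π - t) := by
      rw [← heven₀, ← hper₀ (-π - t)]
      ring_nf
    have hsum := (hseries1 (-π + t)).add (hseries1 (-π - t))
    have hzero (m : ℕ) : sin (((m : ℝ) + 1) * (-π + t)) + sin (((m : ℝ) + 1) * (-π - t)) = 0 := by
      have hs := sin_nat_mul_pi (m + 1)
      push_cast at hs
      rw [mul_add, mul_sub, sin_add, sin_sub, mul_neg, sin_neg, hs]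
      ring
    simp only [← mul_add, hzero, mul_zero] at hsum
    have := hsum.unique hasSum_zero
    simp only [hAdef, hBdef, hΨ]
    linarith
  have hJ (x t : ℝ) : J (x, t) = -A (x + t) + B (x - t) + -(fourierCosCoeff Ψ₁ 0 * π) := by
    have ht (y : ℝ) : -deriv (fun s => ρ (y, s)) t = -A' (y + t) + B' (y - t) := by
      simp_rw [hρAB]
      rw [(hasDerivAt_traveling_time hA hB 0 y t).deriv]
      ring
    simp only [J, ht]
    rw [intervalIntegral.integral_eq_sub_of_hasDerivAt
      (fun y _ => hasDerivAt_traveling_space (fun z => (hA z).neg) hB 0 y t)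
      (Continuous.intervalIntegrable (by fun_prop) _ _)]
    simp only [Pi.neg_apply]
    linarith [hbdry t]
  have hJt (x t : ℝ) : deriv (fun s => J (x, s)) t = -A' (x + t) + -B' (x - t) + 0 := by
    simp_rw [hJ]
    exact (hasDerivAt_traveling_time (fun z => (hA z).neg) hB _ x t).deriv.trans (by ring)
  have hJx (x t : ℝ) : deriv (fun y => J (y, t)) x = -A' (x + t) + B' (x - t) + 0 := by
    simp_rw [hJ]
    exact (hasDerivAt_traveling_space (fun z => (hA z).neg) hB _ x t).deriv.trans (add_zero _).symm
  refine ⟨fun x t => ?_, fun x t => ?_, fun x t => ?_⟩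
  · simp_rw [hJt, hρAB]
    rw [(hasDerivAt_traveling_space hA hB 0 x t).deriv]
    ring
  · simp_rw [hJt, hJx]
    refine (hasDerivAt_traveling_time (fun z => (hA' z).neg) (fun z => (hB' z).neg)
      0 x t).deriv.trans (Eq.trans ?_ (hasDerivAt_traveling_space (fun z => (hA' z).neg) hB'
      0 x t).deriv.symm)
    ring
  constructor
  · refine ⟨_, ((((hseries0 (x + t)).add (hseries0 (x - t))).add
      ((hseries1 (x + t)).sub (hseries1 (x - t)))).div_const 2).congr_fun fun m => ?_, ?_⟩
    · simp only [mul_add _ x t, mul_sub _ x t, sin_add, sin_sub, cos_add, cos_sub]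
      ring
    · simp only [hρAB, hAdef, hBdef, hPdef]
      ring
  · refine ⟨_, ((((hseries0 (x - t)).sub (hseries0 (x + t))).sub
      ((hseries1 (x + t)).add (hseries1 (x - t)))).div_const 2).congr_fun fun m => ?_, ?_⟩
    · simp only [mul_add _ x t, mul_sub _ x t, sin_add, sin_sub, cos_add, cos_sub]
      ring
    · simp only [hJ, hAdef, hBdef, hPdef]
      ring
end

section
/- Let g : ℝ² ∖ {0} → ℝ be smooth and define the circular flow F(x,y) = g(x,y) · (−y/‖(x,y)‖, x/‖(x,y)‖) on the punctured plane. If F is divergence-free on ℝ² ∖ {0}, i.e. ∂F₁/∂x + ∂F₂/∂y = 0 everywhere on ℝ² ∖ {0}, then g depends only on the radius: for all p, q ∈ ℝ² ∖ {0} with ‖p‖ = ‖q‖, g(p) = g(q). -/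
open Real

/-- The divergence `∂F₁/∂x + ∂F₂/∂y` of a planar vector field, computed with the
Fréchet derivative. -/
noncomputable def planarDiv (F : ℝ × ℝ → ℝ × ℝ) (p : ℝ × ℝ) : ℝ :=
  (fderiv ℝ F p (1, 0)).1 + (fderiv ℝ F p (0, 1)).2

lemma planarDiv_smul_rotation {k : ℝ × ℝ → ℝ} {p : ℝ × ℝ} (hk : DifferentiableAt ℝ k p) :
    planarDiv (fun q => (k q * -q.2, k q * q.1)) p = fderiv ℝ k p (-p.2, p.1) := by
  have h₁ := hk.hasFDerivAt.mul (hasFDerivAt_snd (𝕜 := ℝ) (p := p)).neg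
  have h₂ := hk.hasFDerivAt.mul (hasFDerivAt_fst (𝕜 := ℝ) (p := p))
  have hF : HasFDerivAt (fun q : ℝ × ℝ => (k q * -q.2, k q * q.1)) _ p := h₁.prodMk h₂
  have hv : ((-p.2, p.1) : ℝ × ℝ) = (-p.2) • ((1, 0) : ℝ × ℝ) + p.1 • ((0, 1) : ℝ × ℝ) := by
    ext <;> simp
  rw [planarDiv, hF.fderiv, hv, map_add, map_smul, map_smul]
  simp

lemma eq_on_circle_of_fderiv_rotation_eq_zero {k : ℝ × ℝ → ℝ}
    (hk : ∀ p, p ≠ 0 → DifferentiableAt ℝ k p)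
    (hrot : ∀ p : ℝ × ℝ, p ≠ 0 → fderiv ℝ k p (-p.2, p.1) = 0) {r : ℝ} (hr : r ≠ 0) (s t : ℝ) :
    k (r * cos s, r * sin s) = k (r * cos t, r * sin t) := by
  have hderiv (u : ℝ) : HasDerivAt (fun u => k (r * cos u, r * sin u)) 0 u := by
    have hne : ((r * cos u, r * sin u) : ℝ × ℝ) ≠ 0 := by
      intro h
      simp only [Prod.mk_eq_zero, mul_eq_zero, hr, false_or] at h
      have := sin_sq_add_cos_sq u
      simp [h.1, h.2] at this
    have hcurve : HasDerivAt (fun u => (r * cos u, r * sin u)) (r * -sin u, r * cos u) u :=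
      ((hasDerivAt_cos u).const_mul r).prodMk ((hasDerivAt_sin u).const_mul r)
    have h := (hk _ hne).hasFDerivAt.comp_hasDerivAt u hcurve
    have h0 := hrot _ hne
    simp only [← mul_neg] at h0
    rwa [h0] at h
  exact is_const_of_deriv_eq_zero (fun u => (hderiv u).differentiableAt)
    (fun u => (hderiv u).deriv) s t

lemma exists_polar (p : ℝ × ℝ) :
    ∃ t, p = (√(p.1 ^ 2 + p.2 ^ 2) * cos t, √(p.1 ^ 2 + p.2 ^ 2) * sin t) := by
  have hnorm : ‖(⟨p.1, p.2⟩ : ℂ)‖ = √(p.1 ^ 2 + p.2 ^ 2) := by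
    rw [Complex.norm_def, Complex.normSq_mk, sq, sq]
  refine ⟨Complex.arg ⟨p.1, p.2⟩, ?_⟩
  rw [← hnorm, Complex.norm_mul_cos_arg, Complex.norm_mul_sin_arg]

lemma sq_add_sq_pos_of_ne_zero {p : ℝ × ℝ} (hp : p ≠ 0) : 0 < p.1 ^ 2 + p.2 ^ 2 := by
  by_contra! h
  exact hp (Prod.ext (by simpa using (by nlinarith [sq_nonneg p.1, sq_nonneg p.2] : p.1 ^ 2 = 0))
    (by simpa using (by nlinarith [sq_nonneg p.1, sq_nonneg p.2] : p.2 ^ 2 = 0)))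

/-- if the circular flow `F(x,y) = g(x,y) (-y/r, x/r)` is divergence-free
on the punctured plane, then `g` depends only on the radius. -/
theorem divergence_free_circular_flow_radial_density
    (g : ℝ × ℝ → ℝ) (hg : ContDiffOn ℝ (⊤ : ℕ∞) g {p : ℝ × ℝ | p ≠ 0})
    (hdiv : ∀ p : ℝ × ℝ, p ≠ 0 →
      planarDiv (fun q =>
        (g q * (-q.2 / Real.sqrt (q.1 ^ 2 + q.2 ^ 2)),
          g q * (q.1 / Real.sqrt (q.1 ^ 2 + q.2 ^ 2)))) p = 0) :
    ∀ p q : ℝ × ℝ, p ≠ 0 → q ≠ 0 →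
      Real.sqrt (p.1 ^ 2 + p.2 ^ 2) = Real.sqrt (q.1 ^ 2 + q.2 ^ 2) → g p = g q := by
  intro p q hp hq hpq
  have hr : √(p.1 ^ 2 + p.2 ^ 2) ≠ 0 := (sqrt_pos.2 (sq_add_sq_pos_of_ne_zero hp)).ne'
  have hk (x : ℝ × ℝ) (hx : x ≠ 0) :
      DifferentiableAt ℝ (fun x => g x / √(x.1 ^ 2 + x.2 ^ 2)) x := by
    have hpos := sq_add_sq_pos_of_ne_zero hx
    have hgx : DifferentiableAt ℝ g x :=
      (hg.contDiffAt (isOpen_ne.mem_nhds hx)).differentiableAt (by simp)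
    have hsq : DifferentiableAt ℝ (fun x : ℝ × ℝ => x.1 ^ 2 + x.2 ^ 2) x := by fun_prop
    have hsqrt := hsq.sqrt hpos.ne'
    simpa only [div_eq_mul_inv] using hgx.fun_mul (hsqrt.fun_inv (sqrt_pos.2 hpos).ne')
  have hrot (x : ℝ × ℝ) (hx : x ≠ 0) :
      fderiv ℝ (fun x => g x / √(x.1 ^ 2 + x.2 ^ 2)) x (-x.2, x.1) = 0 := by
    rw [← planarDiv_smul_rotation (hk x hx), ← hdiv x hx]
    simp only [div_mul_eq_mul_div, mul_div_assoc]
  obtain ⟨s, hs⟩ := exists_polar p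
  obtain ⟨t, ht⟩ := exists_polar q
  have h := eq_on_circle_of_fderiv_rotation_eq_zero hk hrot hr s t
  rw [← hs, hpq, ← ht, ← hpq] at h
  exact (div_left_inj' hr).1 h
end

section
/- Let Ψ : ℝ → ℝ be smooth, 2π-periodic and nonconstant, and let 0 < ε < 1. Then there is no smooth function ρ on the open annulus Ann(1,ε) = { p ∈ ℝ² : 1−ε < ‖p‖ < 1+ε } such that ρ(cos θ, sin θ) = Ψ(θ) for all θ ∈ ℝ and the circular flow F(x,y) = ρ(x,y) · (−y/‖(x,y)‖, x/‖(x,y)‖) is divergence-free on Ann(1,ε). -/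
open Real

/-- The divergence of a circular flow is the angular derivative of its density. -/
theorem planarDiv_circular {ρ : ℝ × ℝ → ℝ} {p : ℝ × ℝ} (hρ : DifferentiableAt ℝ ρ p)
    (hp : 0 < Real.sqrt (p.1 ^ 2 + p.2 ^ 2)) :
    planarDiv (fun q =>
      (ρ q * (-q.2 / Real.sqrt (q.1 ^ 2 + q.2 ^ 2)),
        ρ q * (q.1 / Real.sqrt (q.1 ^ 2 + q.2 ^ 2)))) p =
      fderiv ℝ ρ p (-p.2 / Real.sqrt (p.1 ^ 2 + p.2 ^ 2),
        p.1 / Real.sqrt (p.1 ^ 2 + p.2 ^ 2)) := by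
  have hfst : HasFDerivAt (fun q : ℝ × ℝ => q.1) (ContinuousLinearMap.fst ℝ ℝ ℝ) p :=
    hasFDerivAt_fst
  have hsnd : HasFDerivAt (fun q : ℝ × ℝ => q.2) (ContinuousLinearMap.snd ℝ ℝ ℝ) p :=
    hasFDerivAt_snd
  have hr := ((hfst.pow 2).fun_add (hsnd.pow 2)).sqrt (Real.sqrt_pos.mp hp).ne'
  have hinv := (hasDerivAt_inv hp.ne').comp_hasFDerivAt p hr
  have hx := hρ.hasFDerivAt.fun_mul (hsnd.fun_neg.fun_mul hinv)
  have hy := hρ.hasFDerivAt.fun_mul (hfst.fun_mul hinv)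
  have hlin (a b : ℝ) : fderiv ℝ ρ p (a, b) =
      a * fderiv ℝ ρ p (1, 0) + b * fderiv ℝ ρ p (0, 1) := by
    rw [← smul_eq_mul, ← smul_eq_mul, ← map_smul, ← map_smul, ← map_add]
    simp
  simp only [Function.comp_apply, ← div_eq_mul_inv] at hx hy
  rw [planarDiv, (hx.prodMk hy).fderiv, hlin (-p.2 / _)]
  simp
  field_simp
  ring

/-- if `Ψ` is smooth, 2π-periodic and nonconstant, then no smooth density
`ρ` on the annulus `Ann(1,ε)` restricting to `Ψ` on the unit circle makes the circular
flow `ρ(x,y)(-y/r, x/r)` divergence-free on the annulus. -/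
theorem no_divergence_free_circular_extension
    (Ψ : ℝ → ℝ) (hΨ : ContDiff ℝ (⊤ : ℕ∞) Ψ)
    (hper : ∀ θ : ℝ, Ψ (θ + 2 * π) = Ψ θ)
    (hnc : ∃ θ₁ θ₂ : ℝ, Ψ θ₁ ≠ Ψ θ₂)
    (ε : ℝ) (hε0 : 0 < ε) (hε1 : ε < 1) :
    ¬ ∃ ρ : ℝ × ℝ → ℝ,
      ContDiffOn ℝ (⊤ : ℕ∞) ρ
        {p : ℝ × ℝ | 1 - ε < Real.sqrt (p.1 ^ 2 + p.2 ^ 2) ∧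
          Real.sqrt (p.1 ^ 2 + p.2 ^ 2) < 1 + ε} ∧
      (∀ θ : ℝ, ρ (Real.cos θ, Real.sin θ) = Ψ θ) ∧
      (∀ p : ℝ × ℝ,
        1 - ε < Real.sqrt (p.1 ^ 2 + p.2 ^ 2) → Real.sqrt (p.1 ^ 2 + p.2 ^ 2) < 1 + ε →
        planarDiv (fun q =>
          (ρ q * (-q.2 / Real.sqrt (q.1 ^ 2 + q.2 ^ 2)),
            ρ q * (q.1 / Real.sqrt (q.1 ^ 2 + q.2 ^ 2)))) p = 0) := by
  rintro ⟨ρ, hρ, hcirc, hdiv⟩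
  have hopen : IsOpen {p : ℝ × ℝ | 1 - ε < Real.sqrt (p.1 ^ 2 + p.2 ^ 2) ∧
      Real.sqrt (p.1 ^ 2 + p.2 ^ 2) < 1 + ε} :=
    (isOpen_lt (f := fun _ => 1 - ε) (g := fun p : ℝ × ℝ => Real.sqrt (p.1 ^ 2 + p.2 ^ 2))
      (by fun_prop) (by fun_prop)).and
      (isOpen_lt (f := fun p : ℝ × ℝ => Real.sqrt (p.1 ^ 2 + p.2 ^ 2)) (g := fun _ => 1 + ε)
      (by fun_prop) (by fun_prop))
  have hderiv (θ : ℝ) : HasDerivAt Ψ 0 θ := by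
    have hr : Real.sqrt (Real.cos θ ^ 2 + Real.sin θ ^ 2) = 1 := by simp
    have hlt : 1 - ε < Real.sqrt (Real.cos θ ^ 2 + Real.sin θ ^ 2) := by linarith
    have hgt : Real.sqrt (Real.cos θ ^ 2 + Real.sin θ ^ 2) < 1 + ε := by linarith
    have hd : DifferentiableAt ℝ ρ (Real.cos θ, Real.sin θ) :=
      (hρ.contDiffAt (hopen.mem_nhds ⟨hlt, hgt⟩)).differentiableAt (by simp)
    have hzero := hdiv (Real.cos θ, Real.sin θ) hlt hgt
    rw [planarDiv_circular hd (hr ▸ one_pos)] at hzero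
    simp only [hr, div_one] at hzero
    have hcomp := hd.hasFDerivAt.comp_hasDerivAt θ
      ((Real.hasDerivAt_cos θ).prodMk (Real.hasDerivAt_sin θ))
    rw [hzero] at hcomp
    exact hcomp.congr_of_eventuallyEq (.of_forall fun t => (hcirc t).symm)
  obtain ⟨θ₁, θ₂, hne⟩ := hnc
  exact hne (is_const_of_deriv_eq_zero (fun θ => (hderiv θ).differentiableAt)
    (fun θ => (hderiv θ).deriv) θ₁ θ₂)
end

section
/- Let w₁, w₂ be smooth real-valued functions on the punctured open unit disk D ∖ {0} = { p ∈ ℝ² : 0 < ‖p‖ < 1 }, suppose the field F(p) = w₁(p)·p/‖p‖ + w₂(p)·(−p₂,p₁)/‖p‖ is divergence-free on D ∖ {0}, and suppose w₁ is bounded on some punctured neighbourhood of the origin. Write w̃ᵢ(r,θ) = wᵢ(r cos θ, r sin θ) and g(r,θ) = −(∂w̃₂/∂θ)(r,θ). If there is L ∈ ℝ such that for every θ, g(r,θ) → L as r → 0⁺, then: (i) r₀ · w̃₁(r₀,θ₀) = ∫_{0}^{r₀} g(r,θ₀) dr for all θ₀ and 0 < r₀ < 1, and (ii) for every θ₀,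 lim_{r→0⁺} w̃₁(r,θ₀) = L. -/
open Real Filter Topology

theorem isOpen_punctured_disk :
    IsOpen {p : ℝ × ℝ | p ≠ 0 ∧ Real.sqrt (p.1 ^ 2 + p.2 ^ 2) < 1} :=
  isOpen_ne.inter (isOpen_lt
    (f := fun p : ℝ × ℝ => Real.sqrt (p.1 ^ 2 + p.2 ^ 2)) (by fun_prop) continuous_const)

theorem sqrt_polar {r : ℝ} (hr : 0 ≤ r) (θ : ℝ) :
    Real.sqrt ((r * Real.cos θ) ^ 2 + (r * Real.sin θ) ^ 2) = r := by
  have h : (r * Real.cos θ) ^ 2 + (r * Real.sin θ) ^ 2 = r ^ 2 := by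
    linear_combination r ^ 2 * Real.sin_sq_add_cos_sq θ
  rw [h, Real.sqrt_sq hr]

theorem polar_ne_zero {r : ℝ} (hr : 0 < r) (θ : ℝ) :
    ((r * Real.cos θ, r * Real.sin θ) : ℝ × ℝ) ≠ 0 := by
  intro h
  have h₁ := sqrt_polar hr.le θ
  simp only [Prod.mk_eq_zero] at h
  rw [h.1, h.2] at h₁
  simp at h₁
  exact hr.ne h₁

/-- The divergence of `w₁ r̂ + w₂ θ̂` in terms of the Fréchet derivatives of `w₁` and `w₂`. -/
theorem planarDiv_radial_add_tangential {w₁ w₂ : ℝ × ℝ → ℝ} {p : ℝ × ℝ}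
    (h₁ : DifferentiableAt ℝ w₁ p) (h₂ : DifferentiableAt ℝ w₂ p) (hp : p ≠ 0) :
    Real.sqrt (p.1 ^ 2 + p.2 ^ 2) * planarDiv (fun q =>
        (w₁ q * (q.1 / Real.sqrt (q.1 ^ 2 + q.2 ^ 2))
            + w₂ q * (-q.2 / Real.sqrt (q.1 ^ 2 + q.2 ^ 2)),
          w₁ q * (q.2 / Real.sqrt (q.1 ^ 2 + q.2 ^ 2))
            + w₂ q * (q.1 / Real.sqrt (q.1 ^ 2 + q.2 ^ 2)))) p =
      w₁ p + fderiv ℝ w₁ p p + fderiv ℝ w₂ p (-p.2, p.1) := by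
  obtain ⟨x, y⟩ := p
  have hpos : 0 < x ^ 2 + y ^ 2 := by
    by_contra! h
    exact hp (Prod.ext (by change x = 0; nlinarith [sq_nonneg x, sq_nonneg y])
      (by change y = 0; nlinarith [sq_nonneg x, sq_nonneg y]))
  have hs : Real.sqrt (x ^ 2 + y ^ 2) ≠ 0 := (Real.sqrt_pos.2 hpos).ne'
  have hsq : Real.sqrt (x ^ 2 + y ^ 2) ^ 2 = x ^ 2 + y ^ 2 := Real.sq_sqrt hpos.le
  have hX : HasDerivAt (fun t : ℝ => ((t, y) : ℝ × ℝ)) (1, 0) x :=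
    (hasDerivAt_id x).prodMk (hasDerivAt_const x y)
  have hY : HasDerivAt (fun t : ℝ => ((x, t) : ℝ × ℝ)) (0, 1) y :=
    (hasDerivAt_const y x).prodMk (hasDerivAt_id y)
  have hF : DifferentiableAt ℝ (fun q : ℝ × ℝ =>
        (w₁ q * (q.1 / Real.sqrt (q.1 ^ 2 + q.2 ^ 2))
            + w₂ q * (-q.2 / Real.sqrt (q.1 ^ 2 + q.2 ^ 2)),
          w₁ q * (q.2 / Real.sqrt (q.1 ^ 2 + q.2 ^ 2))
            + w₂ q * (q.1 / Real.sqrt (q.1 ^ 2 + q.2 ^ 2)))) (x, y) := by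
    have hρ : DifferentiableAt ℝ (fun q : ℝ × ℝ => Real.sqrt (q.1 ^ 2 + q.2 ^ 2)) (x, y) :=
      DifferentiableAt.sqrt (by fun_prop) hpos.ne'
    fun_prop (disch := exact hs)
  have hFX := (ContinuousLinearMap.fst ℝ ℝ ℝ).hasFDerivAt.comp_hasDerivAt x
    (hF.hasFDerivAt.comp_hasDerivAt x hX)
  have hFY := (ContinuousLinearMap.snd ℝ ℝ ℝ).hasFDerivAt.comp_hasDerivAt y
    (hF.hasFDerivAt.comp_hasDerivAt y hY)
  have h₁X := h₁.hasFDerivAt.comp_hasDerivAt x hX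
  have h₁Y := h₁.hasFDerivAt.comp_hasDerivAt y hY
  have h₂X := h₂.hasFDerivAt.comp_hasDerivAt x hX
  have h₂Y := h₂.hasFDerivAt.comp_hasDerivAt y hY
  have hρX : HasDerivAt (fun t : ℝ => Real.sqrt (t ^ 2 + y ^ 2))
      (2 * x / (2 * Real.sqrt (x ^ 2 + y ^ 2))) x := by
    simpa using ((hasDerivAt_pow 2 x).add_const (y ^ 2)).sqrt hpos.ne'
  have hρY : HasDerivAt (fun t : ℝ => Real.sqrt (x ^ 2 + t ^ 2))
      (2 * y / (2 * Real.sqrt (x ^ 2 + y ^ 2))) y := by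
    simpa using ((hasDerivAt_pow 2 y).const_add (x ^ 2)).sqrt hpos.ne'
  have eX := hFX.unique ((h₁X.mul ((hasDerivAt_id x).div hρX hs)).add
    (h₂X.mul ((hasDerivAt_const x (-y)).div hρX hs)))
  have eY := hFY.unique ((h₁Y.mul ((hasDerivAt_id y).div hρY hs)).add
    (h₂Y.mul ((hasDerivAt_const y x).div hρY hs)))
  have ep : fderiv ℝ w₁ (x, y) (x, y) =
      x * fderiv ℝ w₁ (x, y) (1, 0) + y * fderiv ℝ w₁ (x, y) (0, 1) := by
    rw [← smul_eq_mul, ← smul_eq_mul, ← map_smul, ← map_smul, ← map_add]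
    simp
  have eq : fderiv ℝ w₂ (x, y) (-y, x) =
      -y * fderiv ℝ w₂ (x, y) (1, 0) + x * fderiv ℝ w₂ (x, y) (0, 1) := by
    rw [← smul_eq_mul, ← smul_eq_mul, ← map_smul, ← map_smul, ← map_add]
    simp
  rw [ContinuousLinearMap.coe_fst'] at eX
  rw [ContinuousLinearMap.coe_snd'] at eY
  unfold planarDiv
  rw [eX, eY]
  simp only [ep, eq, Function.comp, Pi.div_apply, id]
  generalize Real.sqrt (x ^ 2 + y ^ 2) = s at hs hsq ⊢
  generalize fderiv ℝ w₁ (x, y) (1, 0) = a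
  generalize fderiv ℝ w₁ (x, y) (0, 1) = b
  generalize fderiv ℝ w₂ (x, y) (1, 0) = c
  generalize fderiv ℝ w₂ (x, y) (0, 1) = d
  generalize w₁ (x, y) = u
  generalize w₂ (x, y) = v
  field_simp
  linear_combination u * hsq

theorem hasDerivAt_angular {w : ℝ × ℝ → ℝ} {r θ : ℝ}
    (h : DifferentiableAt ℝ w (r * Real.cos θ, r * Real.sin θ)) :
    HasDerivAt (fun θ' => w (r * Real.cos θ', r * Real.sin θ'))
      (fderiv ℝ w (r * Real.cos θ, r * Real.sin θ) (-(r * Real.sin θ), r * Real.cos θ)) θ := by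
  have hc : HasDerivAt (fun θ' => ((r * Real.cos θ', r * Real.sin θ') : ℝ × ℝ))
      (-(r * Real.sin θ), r * Real.cos θ) θ := by
    simpa using ((Real.hasDerivAt_cos θ).const_mul r).prodMk
      ((Real.hasDerivAt_sin θ).const_mul r)
  exact h.hasFDerivAt.comp_hasDerivAt θ hc

theorem hasDerivAt_mul_radial {w : ℝ × ℝ → ℝ} {r θ : ℝ}
    (h : DifferentiableAt ℝ w (r * Real.cos θ, r * Real.sin θ)) :
    HasDerivAt (fun t => t * w (t * Real.cos θ, t * Real.sin θ))
      (w (r * Real.cos θ, r * Real.sin θ) +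
        fderiv ℝ w (r * Real.cos θ, r * Real.sin θ) (r * Real.cos θ, r * Real.sin θ)) r := by
  have hc : HasDerivAt (fun t : ℝ => ((t * Real.cos θ, t * Real.sin θ) : ℝ × ℝ))
      (Real.cos θ, Real.sin θ) r := by
    simpa using ((hasDerivAt_id r).mul_const (Real.cos θ)).prodMk
      ((hasDerivAt_id r).mul_const (Real.sin θ))
  have hd := (hasDerivAt_id r).mul (h.hasFDerivAt.comp_hasDerivAt r hc)
  have e : fderiv ℝ w (r * Real.cos θ, r * Real.sin θ) (r * Real.cos θ, r * Real.sin θ) =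
      r * fderiv ℝ w (r * Real.cos θ, r * Real.sin θ) (Real.cos θ, Real.sin θ) :=
    (fderiv ℝ w (r * Real.cos θ, r * Real.sin θ)).map_smul r (Real.cos θ, Real.sin θ)
  refine hd.congr_deriv ?_
  rw [e]
  simp

theorem continuousOn_fderiv_angular {w : ℝ × ℝ → ℝ}
    (hw : ContDiffOn ℝ (⊤ : ℕ∞) w {p : ℝ × ℝ | p ≠ 0 ∧ Real.sqrt (p.1 ^ 2 + p.2 ^ 2) < 1})
    (θ : ℝ) :
    ContinuousOn (fun r => fderiv ℝ w (r * Real.cos θ, r * Real.sin θ)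
      (-(r * Real.sin θ), r * Real.cos θ)) (Set.Ioo 0 1) := by
  have hf := hw.continuousOn_fderiv_of_isOpen isOpen_punctured_disk (by simp)
  refine (hf.comp (f := fun r : ℝ => ((r * Real.cos θ, r * Real.sin θ) : ℝ × ℝ))
    (by fun_prop) fun r hr => ?_).clm_apply (by fun_prop)
  exact ⟨polar_ne_zero hr.1 θ, by simpa only [sqrt_polar hr.1.le θ] using hr.2⟩

/-- A function continuous on `(0, a]` with a right limit at `0` is integrable on `[0, a]`. -/
theorem intervalIntegrable_of_tendsto_nhdsGT_zero {g : ℝ → ℝ} {a L : ℝ} (ha : 0 < a)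
    (hg : ContinuousOn g (Set.Ioc 0 a)) (hL : Tendsto g (𝓝[>] 0) (𝓝 L)) :
    IntervalIntegrable g MeasureTheory.volume 0 a := by
  have hc : ContinuousOn (Function.update g 0 L) (Set.Icc 0 a) := by
    rw [continuousOn_update_iff]
    have e : Set.Icc 0 a \ {0} = Set.Ioc 0 a := Set.Icc_sdiff_left
    rw [e]
    exact ⟨hg, fun _ => hL.mono_left (nhdsWithin_mono _ Set.Ioc_subset_Ioi_self)⟩
  refine (hc.intervalIntegrable_of_Icc ha.le).congr fun r hr => ?_
  rw [Set.uIoc_of_le ha.le] at hr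
  exact Function.update_of_ne hr.1.ne' _ _

/-- for a divergence-free flow `F = w₁ r̂ + w₂ θ̂` on the punctured unit
disk with `w₁` bounded near the origin and `g(r,θ) = -(∂w̃₂/∂θ)(r,θ) → L` as `r → 0⁺`,
one has `r₀ w̃₁(r₀,θ₀) = ∫₀^{r₀} g(r,θ₀) dr` and `w̃₁(r,θ₀) → L` as `r → 0⁺`. -/
theorem radial_component_on_punctured_disk
    (w₁ w₂ : ℝ × ℝ → ℝ)
    (hw₁ : ContDiffOn ℝ (⊤ : ℕ∞) w₁
      {p : ℝ × ℝ | p ≠ 0 ∧ Real.sqrt (p.1 ^ 2 + p.2 ^ 2) < 1})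
    (hw₂ : ContDiffOn ℝ (⊤ : ℕ∞) w₂
      {p : ℝ × ℝ | p ≠ 0 ∧ Real.sqrt (p.1 ^ 2 + p.2 ^ 2) < 1})
    (hdiv : ∀ p : ℝ × ℝ, p ≠ 0 → Real.sqrt (p.1 ^ 2 + p.2 ^ 2) < 1 →
      planarDiv (fun q =>
        (w₁ q * (q.1 / Real.sqrt (q.1 ^ 2 + q.2 ^ 2))
            + w₂ q * (-q.2 / Real.sqrt (q.1 ^ 2 + q.2 ^ 2)),
          w₁ q * (q.2 / Real.sqrt (q.1 ^ 2 + q.2 ^ 2))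
            + w₂ q * (q.1 / Real.sqrt (q.1 ^ 2 + q.2 ^ 2)))) p = 0)
    (hbdd : ∃ δ > (0 : ℝ), ∃ M : ℝ, ∀ p : ℝ × ℝ, p ≠ 0 →
      Real.sqrt (p.1 ^ 2 + p.2 ^ 2) < δ → |w₁ p| ≤ M)
    (L : ℝ)
    (hL : ∀ θ : ℝ,
      Tendsto (fun r : ℝ => -(deriv (fun θ' => w₂ (r * Real.cos θ', r * Real.sin θ')) θ))
        (𝓝[>] 0) (𝓝 L)) :
    (∀ θ₀ r₀ : ℝ, 0 < r₀ → r₀ < 1 →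
      r₀ * w₁ (r₀ * Real.cos θ₀, r₀ * Real.sin θ₀) =
        ∫ r in (0 : ℝ)..r₀,
          -(deriv (fun θ' => w₂ (r * Real.cos θ', r * Real.sin θ')) θ₀)) ∧
    (∀ θ₀ : ℝ,
      Tendsto (fun r : ℝ => w₁ (r * Real.cos θ₀, r * Real.sin θ₀)) (𝓝[>] 0) (𝓝 L)) := by
  have hdiff : ∀ {w : ℝ × ℝ → ℝ}, ContDiffOn ℝ (⊤ : ℕ∞) w
      {p : ℝ × ℝ | p ≠ 0 ∧ Real.sqrt (p.1 ^ 2 + p.2 ^ 2) < 1} → ∀ θ r : ℝ, 0 < r → r < 1 →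
      DifferentiableAt ℝ w (r * Real.cos θ, r * Real.sin θ) := fun hw θ r h0 h1 =>
    (hw.contDiffAt (isOpen_punctured_disk.mem_nhds
      ⟨polar_ne_zero h0 θ, by simpa only [sqrt_polar h0.le θ] using h1⟩)).differentiableAt
      (by simp)
  have hder : ∀ θ r : ℝ, 0 < r → r < 1 →
      HasDerivAt (fun t => t * w₁ (t * Real.cos θ, t * Real.sin θ))
        (-(deriv (fun θ' => w₂ (r * Real.cos θ', r * Real.sin θ')) θ)) r := by
    intro θ r h0 h1
    have hp := polar_ne_zero h0 θ
    have e := planarDiv_radial_add_tangential (hdiff hw₁ θ r h0 h1) (hdiff hw₂ θ r h0 h1) hp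
    rw [hdiv _ hp (by simpa only [sqrt_polar h0.le θ] using h1), mul_zero] at e
    refine (hasDerivAt_mul_radial (hdiff hw₁ θ r h0 h1)).congr_deriv ?_
    rw [(hasDerivAt_angular (hdiff hw₂ θ r h0 h1)).deriv]
    linarith
  have hzero : ∀ θ : ℝ, Tendsto (fun t => t * w₁ (t * Real.cos θ, t * Real.sin θ))
      (𝓝[>] 0) (𝓝 0) := by
    intro θ
    obtain ⟨δ, hδ, M, hM⟩ := hbdd
    have hid : Tendsto (fun t : ℝ => t) (𝓝[>] 0) (𝓝 0) := tendsto_nhdsWithin_of_tendsto_nhds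
      tendsto_id
    refine hid.zero_mul_isBoundedUnder_le ⟨M, ?_⟩
    rw [eventually_map]
    filter_upwards [Ioo_mem_nhdsGT hδ] with t ht
    exact hM _ (polar_ne_zero ht.1 θ) (by simpa only [sqrt_polar ht.1.le θ] using ht.2)
  refine ⟨fun θ r₀ h0 h1 => ?_, fun θ => ?_⟩
  · have hcont : ContinuousOn (fun t => t * w₁ (t * Real.cos θ, t * Real.sin θ))
        (Set.Icc 0 r₀) := by
      intro t ht
      rcases ht.1.eq_or_lt with rfl | ht0
      · refine ContinuousWithinAt.mono (t := Set.Ici 0) ?_ Set.Icc_subset_Ici_self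
        rw [← continuousWithinAt_Ioi_iff_Ici]
        simpa [ContinuousWithinAt] using hzero θ
      · exact (hder θ t ht0 (ht.2.trans_lt h1)).continuousAt.continuousWithinAt
    have hg : ContinuousOn
        (fun r => -(deriv (fun θ' => w₂ (r * Real.cos θ', r * Real.sin θ')) θ))
        (Set.Ioc 0 r₀) :=
      (((continuousOn_fderiv_angular hw₂ θ).neg).mono
        fun r hr => ⟨hr.1, hr.2.trans_lt h1⟩).congr fun r hr => by
          rw [(hasDerivAt_angular (hdiff hw₂ θ r hr.1 (hr.2.trans_lt h1))).deriv, Pi.neg_apply]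
    rw [intervalIntegral.integral_eq_sub_of_hasDerivAt_of_le h0.le hcont
      (fun r hr => hder θ r hr.1 (hr.2.trans h1))
      (intervalIntegrable_of_tendsto_nhdsGT_zero h0 hg (hL θ))]
    simp
  · have hslope := hasDerivWithinAt_Ici_of_tendsto_deriv
      (f := fun t => t * w₁ (t * Real.cos θ, t * Real.sin θ)) (s := Set.Ioo 0 1) (a := 0) (e := L)
      (fun r hr => (hder θ r hr.1 hr.2).differentiableAt.differentiableWithinAt)
      (by simpa only [ContinuousWithinAt, zero_mul] using
        (hzero θ).mono_left (nhdsWithin_mono _ Set.Ioo_subset_Ioi_self))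
      (Ioo_mem_nhdsGT one_pos)
      ((hL θ).congr' (by
        filter_upwards [Ioo_mem_nhdsGT one_pos] with r hr
        exact (hder θ r hr.1 hr.2).deriv.symm))
    have ht := (hasDerivWithinAt_iff_tendsto_slope' (by simp)).1 hslope.Ioi_of_Ici
    refine ht.congr' ?_
    filter_upwards [self_mem_nhdsWithin] with r hr
    have hr' : r ≠ 0 := (Set.mem_Ioi.1 hr).ne'
    simp [slope_def_field, hr']
end

section
/- Let Ψ, J : ℝ × ℝ → ℝ be smooth, 2π-periodic in their first variable, and satisfy (∂Ψ/∂t)(x,t) + (∂J/∂x)(x,t) = 0 for all (x,t). Let 0 < ε < 1. Then there exist a smooth function ρ₁ : ℝ³ × ℝ → ℝ and a smooth vector field J̄ : ℝ³ × ℝ → ℝ³ such that: (i) for every t, both ρ₁(·,t) and J̄(·,t) vanish outside the solid annular region { (x,y,z) ∈ ℝ³ : |√(x²+y²) − 1| < ε and |z| < ε }; (ii) the continuity equation (∂ρ₁/∂t) + div J̄ = 0 holds at every point of ℝ³ × ℝ; (iii) for all θ, t: ρ₁(cos θ, sin θ, 0, t) = Ψ(θ,t) and J̄(cos θ, sin θ,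 0, t) = J(θ,t)·(−sin θ, cos θ, 0). -/
open Real

/-- The value at the point `w` of the plane, at time `t`, of a function of angle and time. -/
noncomputable def angularExtension (F : ℝ × ℝ → ℝ) (w : ℂ) (t : ℝ) : ℝ :=
  F (Complex.arg w, t)

lemma eq_of_periodic_of_angle_eq {F : ℝ × ℝ → ℝ} (hF : ∀ x t : ℝ, F (x + 2 * π, t) = F (x, t))
    {a b : ℝ} (t : ℝ) (h : (a : Real.Angle) = b) : F (a, t) = F (b, t) := by
  have hp : Function.Periodic (fun x => F (x, t)) (2 * π) := fun x => hF x t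
  exact (hp.lift_coe a).symm.trans ((congrArg hp.lift h).trans (hp.lift_coe b))

/-- A branch of the argument which is smooth near `w₀`. -/
noncomputable def argBranch (w₀ w : ℂ) : ℝ :=
  (Complex.log (w / w₀)).im + Complex.arg w₀

lemma angularExtension_eq_argBranch {F : ℝ × ℝ → ℝ}
    (hF : ∀ x t : ℝ, F (x + 2 * π, t) = F (x, t)) {w₀ w : ℂ} (h₀ : w₀ ≠ 0) (hw : w ≠ 0) (t : ℝ) :
    angularExtension F w t = F (argBranch w₀ w, t) := by
  apply eq_of_periodic_of_angle_eq hF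
  rw [argBranch, Complex.log_im, Real.Angle.coe_add,
    ← Complex.arg_mul_coe_angle (div_ne_zero hw h₀) h₀, div_mul_cancel₀ _ h₀]

lemma argBranch_self {w : ℂ} (hw : w ≠ 0) : argBranch w w = Complex.arg w := by
  simp [argBranch, hw]

lemma contDiffAt_argBranch {w₀ : ℂ} (h₀ : w₀ ≠ 0) :
    ContDiffAt ℝ (⊤ : ℕ∞) (argBranch w₀) w₀ := by
  have hlog : ContDiffAt ℝ (⊤ : ℕ∞) Complex.log (w₀ / w₀) := by
    rw [div_self h₀]
    exact (Complex.contDiffAt_log Complex.one_mem_slitPlane).restrict_scalars ℝ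
  have hdiv : ContDiffAt ℝ (⊤ : ℕ∞) (fun w : ℂ => w / w₀) w₀ := contDiffAt_id.div_const w₀
  exact (Complex.imCLM.contDiff.contDiffAt.comp w₀ (hlog.comp (f := fun w : ℂ => w / w₀) w₀ hdiv)).add contDiffAt_const

lemma hasDerivAt_argBranch_comp {c : ℝ → ℂ} {c' : ℂ} {x : ℝ} (hc : HasDerivAt c c' x)
    (h₀ : c x ≠ 0) : HasDerivAt (fun s => argBranch (c x) (c s)) (c' / c x).im x := by
  have hlog : HasDerivAt (fun s => Complex.log (c s / c x)) (c' / c x / (c x / c x)) x := by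
    refine (hc.div_const (c x)).clog_real ?_
    rw [div_self h₀]
    exact Complex.one_mem_slitPlane
  rw [div_self h₀, div_one] at hlog
  exact (Complex.imCLM.hasFDerivAt.comp_hasDerivAt x hlog).add_const _

lemma contDiffAt_angularExtension {F : ℝ × ℝ → ℝ} (hF : ContDiff ℝ (⊤ : ℕ∞) F)
    (hper : ∀ x t : ℝ, F (x + 2 * π, t) = F (x, t)) {w₀ : ℂ} (h₀ : w₀ ≠ 0) (t₀ : ℝ) :
    ContDiffAt ℝ (⊤ : ℕ∞) (fun q : ℂ × ℝ => angularExtension F q.1 q.2) (w₀, t₀) := by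
  have hA : ContDiffAt ℝ (⊤ : ℕ∞) (fun q : ℂ × ℝ => (argBranch w₀ q.1, q.2)) (w₀, t₀) :=
    ((contDiffAt_argBranch h₀).comp (w₀, t₀) contDiffAt_fst).prodMk contDiffAt_snd
  refine (hF.contDiffAt.comp (w₀, t₀) hA).congr_of_eventuallyEq ?_
  have hne : ∀ᶠ q : ℂ × ℝ in nhds (w₀, t₀), q.1 ≠ 0 :=
    continuousAt_fst.eventually_ne h₀
  filter_upwards [hne] with q hq
  exact angularExtension_eq_argBranch hper h₀ hq q.2

lemma hasDerivAt_angularExtension_comp {F : ℝ × ℝ → ℝ} (hF : ContDiff ℝ (⊤ : ℕ∞) F)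
    (hper : ∀ x t : ℝ, F (x + 2 * π, t) = F (x, t)) {c : ℝ → ℂ} {c' : ℂ} {x : ℝ}
    (hc : HasDerivAt c c' x) (h₀ : c x ≠ 0) (t : ℝ) :
    HasDerivAt (fun s => angularExtension F (c s) t)
      (deriv (fun θ => F (θ, t)) (Complex.arg (c x)) * (c' / c x).im) x := by
  have hd : DifferentiableAt ℝ (fun θ => F (θ, t)) (Complex.arg (c x)) := by
    have : Differentiable ℝ F := hF.differentiable (by simp)
    fun_prop
  have hF' := hd.hasDerivAt
  rw [← argBranch_self h₀] at hF'
  have h := hF'.comp x (hasDerivAt_argBranch_comp hc h₀)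
  rw [argBranch_self h₀] at h
  refine h.congr_of_eventuallyEq ?_
  filter_upwards [hc.continuousAt.eventually_ne h₀] with s hs
  exact angularExtension_eq_argBranch hper h₀ hs t

/-- The extension of a function of angle and time to space and time, localised by a function of
the squared distance to the axis and a function of the height. -/
noncomputable def cutoffExtension (f g : ℝ → ℝ) (F : ℝ × ℝ → ℝ) (p : (ℝ × ℝ × ℝ) × ℝ) : ℝ :=
  f (p.1.1 ^ 2 + p.1.2.1 ^ 2) * g p.1.2.2 *
    angularExtension F (p.1.1 + p.1.2.1 * Complex.I) p.2

lemma sq_add_sq_ne_zero_iff_complex {x y : ℝ} :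
    x ^ 2 + y ^ 2 ≠ 0 ↔ (x + y * Complex.I : ℂ) ≠ 0 := by
  rw [← Complex.normSq_add_mul_I, ne_eq, Complex.normSq_eq_zero]

lemma contDiff_cutoffExtension {f g : ℝ → ℝ} {F : ℝ × ℝ → ℝ} (hf : ContDiff ℝ (⊤ : ℕ∞) f)
    (hf₀ : f =ᶠ[nhds 0] 0) (hg : ContDiff ℝ (⊤ : ℕ∞) g) (hF : ContDiff ℝ (⊤ : ℕ∞) F)
    (hper : ∀ x t : ℝ, F (x + 2 * π, t) = F (x, t)) :
    ContDiff ℝ (⊤ : ℕ∞) (cutoffExtension f g F) := by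
  rw [contDiff_iff_contDiffAt]
  rintro ⟨⟨x, y, z⟩, t⟩
  have hr : ContDiff ℝ (⊤ : ℕ∞) (fun p : (ℝ × ℝ × ℝ) × ℝ => p.1.1 ^ 2 + p.1.2.1 ^ 2) := by
    fun_prop
  by_cases h : x ^ 2 + y ^ 2 = 0
  · have hz : ∀ᶠ p : (ℝ × ℝ × ℝ) × ℝ in nhds ((x, y, z), t), f (p.1.1 ^ 2 + p.1.2.1 ^ 2) = 0 := by
      have := hr.continuous.tendsto ((x, y, z), t)
      simp only [h] at this
      exact this.eventually hf₀
    refine (contDiffAt_const (c := (0 : ℝ))).congr_of_eventuallyEq ?_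
    filter_upwards [hz] with p hp
    simp [cutoffExtension, hp]
  · have hw : ContDiff ℝ (⊤ : ℕ∞)
        (fun p : (ℝ × ℝ × ℝ) × ℝ => ((p.1.1 + p.1.2.1 * Complex.I : ℂ), p.2)) := by
      have h₁ : ContDiff ℝ (⊤ : ℕ∞) (fun p : (ℝ × ℝ × ℝ) × ℝ => (p.1.1 : ℂ)) :=
        Complex.ofRealCLM.contDiff.comp (by fun_prop)
      have h₂ : ContDiff ℝ (⊤ : ℕ∞) (fun p : (ℝ × ℝ × ℝ) × ℝ => (p.1.2.1 : ℂ)) :=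
        Complex.ofRealCLM.contDiff.comp (by fun_prop)
      fun_prop
    have hE := (contDiffAt_angularExtension hF hper
      (sq_add_sq_ne_zero_iff_complex.1 h) t).comp ((x, y, z), t) hw.contDiffAt
    have hχ : ContDiff ℝ (⊤ : ℕ∞)
        (fun p : (ℝ × ℝ × ℝ) × ℝ => f (p.1.1 ^ 2 + p.1.2.1 ^ 2) * g p.1.2.2) := by
      fun_prop
    exact hχ.contDiffAt.mul hE

lemma hasDerivAt_cutoffExtension_fst {f g : ℝ → ℝ} {F : ℝ × ℝ → ℝ} (hf : ContDiff ℝ (⊤ : ℕ∞) f)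
    (hF : ContDiff ℝ (⊤ : ℕ∞) F) (hper : ∀ x t : ℝ, F (x + 2 * π, t) = F (x, t))
    {x y : ℝ} (h : x ^ 2 + y ^ 2 ≠ 0) (z t : ℝ) :
    HasDerivAt (fun s => cutoffExtension f g F ((s, y, z), t))
      (deriv f (x ^ 2 + y ^ 2) * (2 * x) * g z * angularExtension F (x + y * Complex.I) t +
        f (x ^ 2 + y ^ 2) * g z *
          (deriv (fun θ => F (θ, t)) (Complex.arg (x + y * Complex.I)) *
            (-y / (x ^ 2 + y ^ 2)))) x := by
  have hc : HasDerivAt (fun s : ℝ => (s + y * Complex.I : ℂ)) 1 x :=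
    (HasDerivAt.ofReal_comp (hasDerivAt_id x)).add_const _
  have hE := hasDerivAt_angularExtension_comp hF hper hc (sq_add_sq_ne_zero_iff_complex.1 h) t
  have him : ((1 : ℂ) / (x + y * Complex.I)).im = -y / (x ^ 2 + y ^ 2) := by
    rw [one_div, Complex.inv_im, Complex.normSq_add_mul_I]
    simp
  rw [him] at hE
  have hr : HasDerivAt (fun s : ℝ => s ^ 2 + y ^ 2) (2 * x) x := by
    simpa using (hasDerivAt_pow 2 x).add_const (y ^ 2)
  have hf' := (hf.differentiable (by simp) (x ^ 2 + y ^ 2)).hasDerivAt.comp x hr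
  exact (hf'.mul_const (g z)).mul hE

lemma hasDerivAt_cutoffExtension_snd {f g : ℝ → ℝ} {F : ℝ × ℝ → ℝ} (hf : ContDiff ℝ (⊤ : ℕ∞) f)
    (hF : ContDiff ℝ (⊤ : ℕ∞) F) (hper : ∀ x t : ℝ, F (x + 2 * π, t) = F (x, t))
    {x y : ℝ} (h : x ^ 2 + y ^ 2 ≠ 0) (z t : ℝ) :
    HasDerivAt (fun s => cutoffExtension f g F ((x, s, z), t))
      (deriv f (x ^ 2 + y ^ 2) * (2 * y) * g z * angularExtension F (x + y * Complex.I) t +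
        f (x ^ 2 + y ^ 2) * g z *
          (deriv (fun θ => F (θ, t)) (Complex.arg (x + y * Complex.I)) *
            (x / (x ^ 2 + y ^ 2)))) y := by
  have hc : HasDerivAt (fun s : ℝ => (x + s * Complex.I : ℂ)) Complex.I y := by
    simpa using ((HasDerivAt.ofReal_comp (hasDerivAt_id y)).mul_const Complex.I).const_add (x : ℂ)
  have hE := hasDerivAt_angularExtension_comp hF hper hc (sq_add_sq_ne_zero_iff_complex.1 h) t
  have him : (Complex.I / (x + y * Complex.I)).im = x / (x ^ 2 + y ^ 2) := by
    rw [Complex.div_im, Complex.normSq_add_mul_I]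
    simp
  rw [him] at hE
  have hr : HasDerivAt (fun s : ℝ => x ^ 2 + s ^ 2) (2 * y) y := by
    simpa using (hasDerivAt_pow 2 y).const_add (x ^ 2)
  have hf' := (hf.differentiable (by simp) (x ^ 2 + y ^ 2)).hasDerivAt.comp y hr
  exact (hf'.mul_const (g z)).mul hE

/-- The divergence of the azimuthal field built from a cut-off extension. -/
lemma divergence_cutoffExtension {f g : ℝ → ℝ} {F : ℝ × ℝ → ℝ} (hf : ContDiff ℝ (⊤ : ℕ∞) f)
    (hf₀ : f 0 = 0) (hF : ContDiff ℝ (⊤ : ℕ∞) F)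
    (hper : ∀ x t : ℝ, F (x + 2 * π, t) = F (x, t)) (x y z t : ℝ) :
    deriv (fun s => cutoffExtension f g F ((s, y, z), t) * -y) x +
      deriv (fun s => cutoffExtension f g F ((x, s, z), t) * x) y =
    f (x ^ 2 + y ^ 2) * g z *
      deriv (fun θ => F (θ, t)) (Complex.arg (x + y * Complex.I)) := by
  by_cases h : x ^ 2 + y ^ 2 = 0
  · obtain rfl : x = 0 := by nlinarith [sq_nonneg x, sq_nonneg y]
    obtain rfl : y = 0 := by nlinarith [sq_nonneg y]
    simp [hf₀]
  · rw [((hasDerivAt_cutoffExtension_fst hf hF hper h z t).mul_const (-y)).deriv,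
      ((hasDerivAt_cutoffExtension_snd hf hF hper h z t).mul_const x).deriv]
    field_simp
    ring

lemma deriv_cutoffExtension_time (f g : ℝ → ℝ) (F : ℝ × ℝ → ℝ) (x y z t : ℝ) :
    deriv (fun s => cutoffExtension f g F ((x, y, z), s)) t =
      f (x ^ 2 + y ^ 2) * g z *
        deriv (fun s => F (Complex.arg (x + y * Complex.I), s)) t := by
  simp [cutoffExtension, angularExtension, deriv_const_mul_field]

lemma cutoffExtension_circle {f g : ℝ → ℝ} {F : ℝ × ℝ → ℝ} (hf : f 1 = 1) (hg : g 0 = 1)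
    (hper : ∀ x t : ℝ, F (x + 2 * π, t) = F (x, t)) (θ t : ℝ) :
    cutoffExtension f g F ((Real.cos θ, Real.sin θ, 0), t) = F (θ, t) := by
  have h : angularExtension F (Real.cos θ + Real.sin θ * Complex.I) t = F (θ, t) := by
    apply eq_of_periodic_of_angle_eq hper
    have := Complex.arg_cos_add_sin_mul_I_coe_angle (θ : Real.Angle)
    simpa using this
  simp only [cutoffExtension]
  rw [h, Real.cos_sq_add_sin_sq, hf, hg, one_mul, one_mul]

/-- If the squared radius is close enough to `1`, then so is the radius. -/
lemma abs_sqrt_sub_one_lt {s ε : ℝ} (hε0 : 0 < ε) (hε1 : ε < 1)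
    (h : |s - 1| < ε * (2 - ε)) : |Real.sqrt s - 1| < ε := by
  rw [abs_lt] at h ⊢
  constructor
  · have : 1 - ε < Real.sqrt s := Real.lt_sqrt_of_sq_lt (by nlinarith)
    linarith
  · have : Real.sqrt s < 1 + ε := (Real.sqrt_lt' (by linarith)).2 (by nlinarith)
    linarith

/-- a pair `(Ψ, J)` satisfying the 1-dimensional continuity equation on
the circle extends to a smooth pair `(ρ₁, J̄)` on ℝ³, supported in the solid annular
region `{ |√(x²+y²) - 1| < ε, |z| < ε }`, satisfying the 3-dimensional continuity
equation and restricting to `(Ψ, J)` on the unit circle. -/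
theorem extension_of_charge_and_current
    (Ψ J : ℝ × ℝ → ℝ)
    (hΨ : ContDiff ℝ (⊤ : ℕ∞) Ψ) (hJ : ContDiff ℝ (⊤ : ℕ∞) J)
    (hperΨ : ∀ x t : ℝ, Ψ (x + 2 * π, t) = Ψ (x, t))
    (hperJ : ∀ x t : ℝ, J (x + 2 * π, t) = J (x, t))
    (hcont : ∀ x t : ℝ,
      deriv (fun s => Ψ (x, s)) t + deriv (fun y => J (y, t)) x = 0)
    (ε : ℝ) (hε0 : 0 < ε) (hε1 : ε < 1) :
    ∃ (ρ₁ : (ℝ × ℝ × ℝ) × ℝ → ℝ) (Jv : (ℝ × ℝ × ℝ) × ℝ → ℝ × ℝ × ℝ),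
      ContDiff ℝ (⊤ : ℕ∞) ρ₁ ∧ ContDiff ℝ (⊤ : ℕ∞) Jv ∧
      -- (i) support condition
      (∀ (x y z t : ℝ),
        ¬ (|Real.sqrt (x ^ 2 + y ^ 2) - 1| < ε ∧ |z| < ε) →
        ρ₁ ((x, y, z), t) = 0 ∧ Jv ((x, y, z), t) = 0) ∧
      -- (ii) continuity equation
      (∀ (x y z t : ℝ),
        deriv (fun s => ρ₁ ((x, y, z), s)) t
          + deriv (fun x' => (Jv ((x', y, z), t)).1) x
          + deriv (fun y' => (Jv ((x, y', z), t)).2.1) y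
          + deriv (fun z' => (Jv ((x, y, z'), t)).2.2) z = 0) ∧
      -- (iii) restriction to the unit circle
      (∀ θ t : ℝ,
        ρ₁ ((Real.cos θ, Real.sin θ, 0), t) = Ψ (θ, t) ∧
        Jv ((Real.cos θ, Real.sin θ, 0), t) =
          (J (θ, t) * (-Real.sin θ), J (θ, t) * Real.cos θ, 0)) := by
  have hr0 : 0 < ε * (2 - ε) := mul_pos hε0 (by linarith)
  have hr1 : ε * (2 - ε) < 1 := by nlinarith [sq_pos_of_pos (sub_pos.2 hε1)]
  let f : ContDiffBump (1 : ℝ) := ⟨ε * (2 - ε) / 2, ε * (2 - ε), half_pos hr0, half_lt_self hr0⟩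
  let g : ContDiffBump (0 : ℝ) := ⟨ε / 2, ε, half_pos hε0, half_lt_self hε0⟩
  have hf1 : f 1 = 1 := f.one_of_mem_closedBall (Metric.mem_closedBall_self f.rIn_pos.le)
  have hg1 : g 0 = 1 := g.one_of_mem_closedBall (Metric.mem_closedBall_self g.rIn_pos.le)
  have hf₀ : (f : ℝ → ℝ) =ᶠ[nhds 0] 0 := by
    filter_upwards [gt_mem_nhds (sub_pos.2 hr1)] with s hs
    refine f.zero_of_le_dist ?_
    rw [Real.dist_eq]
    exact le_trans (by linarith) (neg_le_abs (s - 1))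
  have hfs : ContDiff ℝ (⊤ : ℕ∞) f := f.contDiff
  have hgs : ContDiff ℝ (⊤ : ℕ∞) g := g.contDiff
  have hJs := contDiff_cutoffExtension hfs hf₀ hgs hJ hperJ
  refine ⟨cutoffExtension f g Ψ, fun p =>
    (cutoffExtension f g J p * -p.1.2.1, cutoffExtension f g J p * p.1.1, 0),
    contDiff_cutoffExtension hfs hf₀ hgs hΨ hperΨ, by fun_prop, ?_, ?_, ?_⟩
  · intro x y z t h
    have hfg : f (x ^ 2 + y ^ 2) * g z = 0 := by
      by_contra hne
      obtain ⟨hfne, hgne⟩ := mul_ne_zero_iff.1 hne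
      refine h ⟨abs_sqrt_sub_one_lt hε0 hε1 ?_, ?_⟩
      · by_contra! hle
        exact hfne (f.zero_of_le_dist hle)
      · by_contra! hle
        exact hgne (g.zero_of_le_dist (by simpa [Real.dist_eq] using hle))
    simp [cutoffExtension, hfg]
  · intro x y z t
    have hdiv := divergence_cutoffExtension (g := g) hfs hf₀.self_of_nhds hJ hperJ x y z t
    have htime := deriv_cutoffExtension_time f g Ψ x y z t
    simp only [deriv_const, add_zero]
    rw [add_assoc, hdiv, htime, ← mul_add, hcont, mul_zero]
  · intro θ t
    simp only [cutoffExtension_circle hf1 hg1 hperΨ, cutoffExtension_circle hf1 hg1 hperJ,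
      and_self]
end

section
/- Let p, j : ℝ × ℝ → ℝ be smooth, 2π-periodic in their first variable, and suppose that for every t ∈ ℝ, sup{ |p(θ,s)| + |(∂p/∂t)(θ,s)| + |j(θ,s)| + |(∂j/∂t)(θ,s)| : θ ∈ ℝ, s ≤ t } < ∞. Define the five Jefimenko field terms for p ∈ ℝ³ with distance from the unit circle {(cosθ,sinθ,0)} positive: E₁(p,t) = (1/(4πε₀))∫_{-π}^{π} (ρ(θ,t_r)/𝔯²)·(p−r′(θ))/𝔯 dθ, E₂(p,t) = (1/(4πε₀))∫_{-π}^{π} ((∂ₜρ)(θ,t_r)/(c𝔯))·(p−r′(θ))/𝔯 dθ, E₃(p,t) = −(1/(4πε₀))∫_{-π}^{π} (∂ₜJ̄)(θ,t_r)/(c²𝔯) dθ, B₁(p,t) = (μ₀/(4π))∫_{-π}^{π} (J̄(θ,t_r)/𝔯²) × (p−r′(θ))/𝔯 dθ, B₂(p,t) = (μ₀/(4π))∫_{-π}^{π} ((∂ₜJ̄)(θ,t_r)/(c𝔯)) × (p−r′(θ))/𝔯 dθ, where ρ = p, J̄(θ,t) = j(θ,t)(−sinθ, cosθ, 0), r′(θ)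 = (cosθ, sinθ, 0), 𝔯 = ‖p − r′(θ)‖, t_r = t − 𝔯/c, and ε₀, μ₀, c > 0 with c² = 1/(ε₀μ₀) and c > 1. Let E = E₁+E₂+E₃, B = B₁+B₂, and for r > 1 let P(r,t) and Q(r,t) be the fluxes of E×B and of E₂×B₂ + E₃×B₂ respectively through the sphere of radius r centred at the origin. Then for every t ∈ ℝ, lim_{r→∞} ( P(r,t) − Q(r,t) ) = 0. -/
open Real Filter Topology

noncomputable section

/-- Cross product in ℝ³ (represented as `ℝ × ℝ × ℝ`). -/
def cross3 (a b : ℝ × ℝ × ℝ) : ℝ × ℝ × ℝ :=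
  (a.2.1 * b.2.2 - a.2.2 * b.2.1, a.2.2 * b.1 - a.1 * b.2.2, a.1 * b.2.1 - a.2.1 * b.1)

/-- Dot product in ℝ³. -/
def dot3 (a b : ℝ × ℝ × ℝ) : ℝ := a.1 * b.1 + a.2.1 * b.2.1 + a.2.2 * b.2.2

/-- Euclidean norm in ℝ³. -/
def norm3 (a : ℝ × ℝ × ℝ) : ℝ := Real.sqrt (a.1 ^ 2 + a.2.1 ^ 2 + a.2.2 ^ 2)

/-- Flux of a vector field through the sphere of radius `r` centred at the origin. -/
def sphereFlux (V : ℝ × ℝ × ℝ → ℝ × ℝ × ℝ) (r : ℝ) : ℝ :=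
  ∫ φ in (0:ℝ)..π, ∫ θ in (-π)..π,
    dot3 (V (r * (Real.sin φ * Real.cos θ), r * (Real.sin φ * Real.sin θ), r * Real.cos φ))
        (Real.sin φ * Real.cos θ, Real.sin φ * Real.sin θ, Real.cos φ)
      * r ^ 2 * Real.sin φ

end

noncomputable section

/-- The point of the sphere of radius `r` with polar angle `p.1` and azimuth `p.2`. -/
def spherePoint (r : ℝ) (p : ℝ × ℝ) : ℝ × ℝ × ℝ :=
  (r * (Real.sin p.1 * Real.cos p.2), r * (Real.sin p.1 * Real.sin p.2), r * Real.cos p.1)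

/-- The point of the unit circle with angle `θ`. -/
def circlePoint (θ : ℝ) : ℝ × ℝ × ℝ := (Real.cos θ, Real.sin θ, 0)

/-- `F` is continuous on all spheres of radius `r ≥ 2` and is `O(r⁻ⁿ)` on them. -/
def SphereDecay (F : ℝ × ℝ × ℝ → ℝ × ℝ × ℝ) (n : ℕ) : Prop :=
  ∃ K : ℝ, ∀ r : ℝ, 2 ≤ r → Continuous (fun p : ℝ × ℝ => F (spherePoint r p)) ∧
    ∀ p : ℝ × ℝ, ‖F (spherePoint r p)‖ ≤ K / r ^ n

@[fun_prop]
theorem continuous_spherePoint (r : ℝ) : Continuous (spherePoint r) := by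
  unfold spherePoint; fun_prop

@[fun_prop]
theorem continuous_circlePoint : Continuous circlePoint := by
  unfold circlePoint; fun_prop

@[fun_prop]
theorem continuous_norm3 : Continuous norm3 := by
  unfold norm3; fun_prop

theorem norm3_nonneg (a : ℝ × ℝ × ℝ) : 0 ≤ norm3 a := Real.sqrt_nonneg _

theorem norm_le_norm3 (a : ℝ × ℝ × ℝ) : ‖a‖ ≤ norm3 a := by
  simp only [Prod.norm_def, Real.norm_eq_abs, norm3]
  refine max_le ?_ (max_le ?_ ?_) <;> apply Real.abs_le_sqrt <;>
    nlinarith [sq_nonneg a.1, sq_nonneg a.2.1, sq_nonneg a.2.2]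

theorem norm_cross3_le (a b : ℝ × ℝ × ℝ) : ‖cross3 a b‖ ≤ 2 * (‖a‖ * ‖b‖) := by
  have key : ∀ u v w z : ℝ, |u| ≤ ‖a‖ → |v| ≤ ‖b‖ → |w| ≤ ‖a‖ → |z| ≤ ‖b‖ →
      |u * v - w * z| ≤ 2 * (‖a‖ * ‖b‖) := by
    intro u v w z hu hv hw hz
    have h1 : |u * v| ≤ ‖a‖ * ‖b‖ := by rw [abs_mul]; gcongr
    have h2 : |w * z| ≤ ‖a‖ * ‖b‖ := by rw [abs_mul]; gcongr
    linarith [abs_sub (u * v) (w * z)]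
  have a1 : |a.1| ≤ ‖a‖ := norm_fst_le a
  have a2 : |a.2.1| ≤ ‖a‖ := (norm_fst_le a.2).trans (norm_snd_le a)
  have a3 : |a.2.2| ≤ ‖a‖ := (norm_snd_le a.2).trans (norm_snd_le a)
  have b1 : |b.1| ≤ ‖b‖ := norm_fst_le b
  have b2 : |b.2.1| ≤ ‖b‖ := (norm_fst_le b.2).trans (norm_snd_le b)
  have b3 : |b.2.2| ≤ ‖b‖ := (norm_snd_le b.2).trans (norm_snd_le b)
  exact max_le (key _ _ _ _ a2 b3 a3 b2)
    (max_le (key _ _ _ _ a3 b1 a1 b3) (key _ _ _ _ a1 b2 a2 b1))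

theorem continuous_cross3 :
    Continuous (fun p : (ℝ × ℝ × ℝ) × (ℝ × ℝ × ℝ) => cross3 p.1 p.2) := by
  unfold cross3; fun_prop

theorem norm_tangent_le (θ : ℝ) : ‖((-Real.sin θ, Real.cos θ, 0) : ℝ × ℝ × ℝ)‖ ≤ 1 := by
  simp [Prod.norm_def, Real.abs_sin_le_one, Real.abs_cos_le_one]

theorem sub_one_le_norm3_sub_circlePoint {r : ℝ} (hr : 1 ≤ r) (p : ℝ × ℝ) (θ : ℝ) :
    r - 1 ≤ norm3 (spherePoint r p - circlePoint θ) := by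
  apply Real.le_sqrt_of_sq_le
  have h1 := Real.sin_sq_add_cos_sq p.1
  have h2 := Real.sin_sq_add_cos_sq p.2
  have h3 := Real.sin_sq_add_cos_sq θ
  have h4 : Real.sin p.1 * Real.cos (p.2 - θ) ≤ 1 := by
    refine (le_abs_self _).trans ?_
    rw [abs_mul]
    exact mul_le_one₀ (Real.abs_sin_le_one _) (abs_nonneg _) (Real.abs_cos_le_one _)
  rw [Real.cos_sub] at h4
  simp only [spherePoint, circlePoint, Prod.fst_sub, Prod.snd_sub, sub_zero]
  have h5 : (r * (Real.sin p.1 * Real.cos p.2) - Real.cos θ) ^ 2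
      + (r * (Real.sin p.1 * Real.sin p.2) - Real.sin θ) ^ 2 + (r * Real.cos p.1) ^ 2
      = r ^ 2 + 1 - 2 * r * (Real.sin p.1 *
        (Real.cos p.2 * Real.cos θ + Real.sin p.2 * Real.sin θ)) := by
    linear_combination r ^ 2 * h1 + r ^ 2 * Real.sin p.1 ^ 2 * h2 + h3
  rw [h5]
  nlinarith

theorem SphereDecay.add {F G : ℝ × ℝ × ℝ → ℝ × ℝ × ℝ} {n : ℕ} (hF : SphereDecay F n)
    (hG : SphereDecay G n) : SphereDecay (fun x => F x + G x) n := by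
  obtain ⟨K, hK⟩ := hF
  obtain ⟨L, hL⟩ := hG
  refine ⟨K + L, fun r hr => ⟨(hK r hr).1.add (hL r hr).1, fun p => ?_⟩⟩
  rw [add_div]
  exact (norm_add_le _ _).trans (add_le_add ((hK r hr).2 p) ((hL r hr).2 p))

theorem SphereDecay.const_smul {F : ℝ × ℝ × ℝ → ℝ × ℝ × ℝ} {n : ℕ} (hF : SphereDecay F n)
    (a : ℝ) : SphereDecay (fun x => a • F x) n := by
  obtain ⟨K, hK⟩ := hF
  refine ⟨|a| * K, fun r hr => ⟨(hK r hr).1.const_smul a, fun p => ?_⟩⟩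
  rw [norm_smul, mul_div_assoc, Real.norm_eq_abs]
  exact mul_le_mul_of_nonneg_left ((hK r hr).2 p) (abs_nonneg a)

theorem SphereDecay.neg {F : ℝ × ℝ × ℝ → ℝ × ℝ × ℝ} {n : ℕ} (hF : SphereDecay F n) :
    SphereDecay (fun x => -F x) n := by
  simpa using hF.const_smul (-1)

theorem SphereDecay.of_succ {F : ℝ × ℝ × ℝ → ℝ × ℝ × ℝ} {n : ℕ} (hF : SphereDecay F (n + 1)) :
    SphereDecay F n := by
  obtain ⟨K, hK⟩ := hF
  refine ⟨K, fun r hr => ⟨(hK r hr).1, fun p => ?_⟩⟩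
  have h := (norm_nonneg _).trans ((hK r hr).2 p)
  have hr0 : 0 < r := by linarith
  have hK0 : 0 ≤ K := by
    rw [le_div_iff₀ (by positivity)] at h
    simpa using h
  refine ((hK r hr).2 p).trans ?_
  gcongr <;> linarith

theorem SphereDecay.cross {F G : ℝ × ℝ × ℝ → ℝ × ℝ × ℝ} {m n : ℕ} (hF : SphereDecay F m)
    (hG : SphereDecay G n) : SphereDecay (fun x => cross3 (F x) (G x)) (m + n) := by
  obtain ⟨K, hK⟩ := hF
  obtain ⟨L, hL⟩ := hG
  refine ⟨2 * (K * L), fun r hr =>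
    ⟨continuous_cross3.comp ((hK r hr).1.prodMk (hL r hr).1), fun p => ?_⟩⟩
  refine (norm_cross3_le _ _).trans ?_
  rw [mul_div_assoc, pow_add, ← div_mul_div_comm]
  exact mul_le_mul_of_nonneg_left (mul_le_mul ((hK r hr).2 p) ((hL r hr).2 p) (norm_nonneg _)
    ((norm_nonneg _).trans ((hK r hr).2 p))) zero_le_two

theorem sphereDecay_integral {k : ℝ × ℝ × ℝ → ℝ → ℝ × ℝ × ℝ} {M : ℝ} {n : ℕ} (hM : 0 ≤ M)
    (hk : ContinuousOn (fun p : (ℝ × ℝ × ℝ) × ℝ => k p.1 p.2)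
      {p | norm3 (p.1 - circlePoint p.2) ≠ 0})
    (hb : ∀ x θ, 0 < norm3 (x - circlePoint θ) →
      ‖k x θ‖ ≤ M / norm3 (x - circlePoint θ) ^ n) :
    SphereDecay (fun x => ∫ θ in (-π)..π, k x θ) n := by
  refine ⟨M * 2 ^ n * (2 * π), fun r hr => ⟨?_, fun p => ?_⟩⟩
  · apply intervalIntegral.continuous_parametric_intervalIntegral_of_continuous'
    exact hk.comp_continuous (f := fun p : (ℝ × ℝ) × ℝ => (spherePoint r p.1, p.2))
      (by fun_prop) fun p => by
        have := sub_one_le_norm3_sub_circlePoint (by linarith : 1 ≤ r) p.1 p.2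
        have : 0 < norm3 (spherePoint r p.1 - circlePoint p.2) := by linarith
        exact this.ne'
  · have h : ∀ θ ∈ Set.uIoc (-π) π, ‖k (spherePoint r p) θ‖ ≤ M * 2 ^ n / r ^ n := by
      intro θ _
      have h1 := sub_one_le_norm3_sub_circlePoint (by linarith : 1 ≤ r) p θ
      have h2 : r / 2 ≤ norm3 (spherePoint r p - circlePoint θ) := by linarith
      refine (hb _ _ (by linarith)).trans ?_
      have h3 : M * 2 ^ n / r ^ n = M / (r / 2) ^ n := by
        rw [div_pow, div_div_eq_mul_div]
      rw [h3]
      gcongr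
    refine (intervalIntegral.norm_integral_le_of_norm_le_const h).trans_eq ?_
    rw [show π - -π = 2 * π by ring, abs_of_pos Real.two_pi_pos]
    ring

theorem continuous_dot3_radial {w : ℝ × ℝ → ℝ × ℝ × ℝ} (hw : Continuous w) (r : ℝ) :
    Continuous (fun p : ℝ × ℝ => dot3 (w p)
      (Real.sin p.1 * Real.cos p.2, Real.sin p.1 * Real.sin p.2, Real.cos p.1)
      * r ^ 2 * Real.sin p.1) := by
  unfold dot3
  fun_prop

theorem sphereFlux_sub {V W : ℝ × ℝ × ℝ → ℝ × ℝ × ℝ} {r : ℝ}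
    (hV : Continuous (fun p : ℝ × ℝ => V (spherePoint r p)))
    (hW : Continuous (fun p : ℝ × ℝ => W (spherePoint r p))) :
    sphereFlux V r - sphereFlux W r = sphereFlux (fun x => V x - W x) r := by
  have key : ∀ U : ℝ × ℝ × ℝ → ℝ × ℝ × ℝ, Continuous (fun p : ℝ × ℝ => U (spherePoint r p)) →
      Continuous (fun p : ℝ × ℝ => dot3 (U (r * (Real.sin p.1 * Real.cos p.2),
        r * (Real.sin p.1 * Real.sin p.2), r * Real.cos p.1))
        (Real.sin p.1 * Real.cos p.2, Real.sin p.1 * Real.sin p.2, Real.cos p.1)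
        * r ^ 2 * Real.sin p.1) :=
    fun U hU => continuous_dot3_radial hU r
  have hV' := key V hV
  have hW' := key W hW
  unfold sphereFlux
  rw [← intervalIntegral.integral_sub]
  · refine intervalIntegral.integral_congr fun φ _ => ?_
    simp only
    rw [← intervalIntegral.integral_sub]
    · refine intervalIntegral.integral_congr fun θ _ => ?_
      simp only [dot3, Prod.fst_sub, Prod.snd_sub]
      ring
    · exact (hV'.comp (by fun_prop : Continuous fun θ : ℝ => (φ, θ))).intervalIntegrable _ _
    · exact (hW'.comp (by fun_prop : Continuous fun θ : ℝ => (φ, θ))).intervalIntegrable _ _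
  · exact (intervalIntegral.continuous_parametric_intervalIntegral_of_continuous' hV'
      _ _).intervalIntegrable _ _
  · exact (intervalIntegral.continuous_parametric_intervalIntegral_of_continuous' hW'
      _ _).intervalIntegrable _ _

theorem abs_sphereFlux_le {V : ℝ × ℝ × ℝ → ℝ × ℝ × ℝ} {r K : ℝ}
    (hV : ∀ p, ‖V (spherePoint r p)‖ ≤ K) :
    |sphereFlux V r| ≤ 6 * π ^ 2 * K * r ^ 2 := by
  have hK : 0 ≤ K := (norm_nonneg _).trans (hV 0)
  have h1 : ∀ φ θ : ℝ, ‖dot3 (V (r * (Real.sin φ * Real.cos θ), r * (Real.sin φ * Real.sin θ),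
      r * Real.cos φ)) (Real.sin φ * Real.cos θ, Real.sin φ * Real.sin θ, Real.cos φ)
      * r ^ 2 * Real.sin φ‖ ≤ 3 * K * r ^ 2 := by
    intro φ θ
    have hv := hV (φ, θ)
    simp only [spherePoint] at hv
    generalize V _ = v at hv ⊢
    have v1 : |v.1| ≤ K := (norm_fst_le v).trans hv
    have v2 : |v.2.1| ≤ K := ((norm_fst_le v.2).trans (norm_snd_le v)).trans hv
    have v3 : |v.2.2| ≤ K := ((norm_snd_le v.2).trans (norm_snd_le v)).trans hv
    have s1 := Real.abs_sin_le_one φ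
    have key : ∀ u w : ℝ, |u| ≤ K → |w| ≤ 1 → |u * w| ≤ K := by
      intro u w hu hw
      rw [abs_mul]
      exact (mul_le_of_le_one_right (abs_nonneg u) hw).trans hu
    have d1 := key _ (Real.sin φ * Real.cos θ) v1 (by
      rw [abs_mul]; exact mul_le_one₀ s1 (abs_nonneg _) (Real.abs_cos_le_one _))
    have d2 := key _ (Real.sin φ * Real.sin θ) v2 (by
      rw [abs_mul]; exact mul_le_one₀ s1 (abs_nonneg _) (Real.abs_sin_le_one _))
    have d3 := key _ (Real.cos φ) v3 (Real.abs_cos_le_one _)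
    rw [Real.norm_eq_abs, abs_mul, abs_mul, abs_of_nonneg (sq_nonneg r)]
    refine (mul_le_of_le_one_right (by positivity) s1).trans ?_
    gcongr
    unfold dot3
    refine (abs_add_three _ _ _).trans ?_
    linarith
  have h2 : ∀ φ ∈ Set.uIoc 0 π, ‖∫ θ in (-π)..π,
      dot3 (V (r * (Real.sin φ * Real.cos θ), r * (Real.sin φ * Real.sin θ),
      r * Real.cos φ)) (Real.sin φ * Real.cos θ, Real.sin φ * Real.sin θ, Real.cos φ)
      * r ^ 2 * Real.sin φ‖ ≤ 3 * K * r ^ 2 * |π - -π| := fun φ _ =>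
    intervalIntegral.norm_integral_le_of_norm_le_const fun θ _ => h1 φ θ
  refine (intervalIntegral.norm_integral_le_of_norm_le_const h2).trans_eq ?_
  rw [show π - -π = 2 * π by ring, sub_zero, abs_of_pos Real.two_pi_pos, abs_of_pos Real.pi_pos]
  ring

theorem SphereDecay.tendsto_sphereFlux {V : ℝ × ℝ × ℝ → ℝ × ℝ × ℝ} (hV : SphereDecay V 3) :
    Tendsto (sphereFlux V) atTop (𝓝 0) := by
  obtain ⟨K, hK⟩ := hV
  refine squeeze_zero_norm' (a := fun r => 6 * π ^ 2 * K / r) ?_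
    (tendsto_const_nhds.div_atTop tendsto_id)
  filter_upwards [eventually_ge_atTop 2] with r hr
  refine (abs_sphereFlux_le (hK r hr).2).trans_eq ?_
  have : r ≠ 0 := by linarith
  field_simp

theorem SphereDecay.tendsto_flux_cross_sub {E₁ E₂ E₃ B₁ B₂ : ℝ × ℝ × ℝ → ℝ × ℝ × ℝ}
    (hE₁ : SphereDecay E₁ 2) (hE₂ : SphereDecay E₂ 1) (hE₃ : SphereDecay E₃ 1)
    (hB₁ : SphereDecay B₁ 2) (hB₂ : SphereDecay B₂ 1) :
    Tendsto (fun r =>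
      sphereFlux (fun x => cross3 (E₁ x + E₂ x + E₃ x) (B₁ x + B₂ x)) r -
      sphereFlux (fun x => cross3 (E₂ x) (B₂ x) + cross3 (E₃ x) (B₂ x)) r)
      atTop (𝓝 0) := by
  have h := ((hE₁.cross (hB₁.of_succ.add hB₂)).add
    ((hE₂.add hE₃).cross hB₁)).tendsto_sphereFlux
  obtain ⟨K, hK⟩ := ((hE₁.of_succ.add hE₂).add hE₃).cross (hB₁.of_succ.add hB₂)
  obtain ⟨L, hL⟩ := (hE₂.cross hB₂).add (hE₃.cross hB₂)
  refine h.congr' ?_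
  filter_upwards [eventually_ge_atTop 2] with r hr
  rw [sphereFlux_sub (hK r hr).1 (hL r hr).1]
  congr 1
  funext x
  ext <;>
    simp only [cross3, Prod.fst_sub, Prod.snd_sub, Prod.fst_add, Prod.snd_add] <;>
    ring

theorem continuous_deriv_snd {f : ℝ × ℝ → ℝ} (hf : ContDiff ℝ 1 f) :
    Continuous (fun p : ℝ × ℝ => deriv (fun u => f (p.1, u)) p.2) := by
  have h : ∀ p : ℝ × ℝ, deriv (fun u => f (p.1, u)) p.2 = fderiv ℝ f p (0, 1) := by
    intro p
    have h1 : HasFDerivAt f (fderiv ℝ f p) (p.1, p.2) :=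
      (hf.differentiable one_ne_zero p).hasFDerivAt
    have h2 : HasDerivAt (fun u : ℝ => (p.1, u)) ((0 : ℝ), (1 : ℝ)) p.2 :=
      (hasDerivAt_const _ _).prodMk (hasDerivAt_id _)
    exact (h1.comp_hasDerivAt p.2 h2).deriv
  simp only [h]
  exact (hf.continuous_fderiv one_ne_zero).clm_apply continuous_const

section Kernels

variable {g : ℝ × ℝ → ℝ} {M c t : ℝ}

/-- The integral `∫ g(θ, t_r) / (a 𝔯ⁿ⁺¹) (x - γ(θ)) dθ` decays like `r⁻ⁿ`. -/
theorem sphereDecay_radial (hg : Continuous g) (hM : 0 ≤ M) (hc : 0 < c)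
    (hb : ∀ θ s, s ≤ t → |g (θ, s)| ≤ M) {a : ℝ} (ha : 1 ≤ a) (n : ℕ) :
    SphereDecay (fun x => ∫ θ in (-π)..π,
      (g (θ, t - norm3 (x - circlePoint θ) / c) / (a * norm3 (x - circlePoint θ) ^ (n + 1))) •
        (x - circlePoint θ)) n := by
  have ha0 : 0 < a := by linarith
  refine sphereDecay_integral hM ?_ fun x θ hd => ?_
  · apply ContinuousOn.fun_smul
    · apply ContinuousOn.div
      · fun_prop
      · fun_prop
      · exact fun p hp => mul_ne_zero ha0.ne' (pow_ne_zero _ hp)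
    · fun_prop
  · have h1 := norm_le_norm3 (x - circlePoint θ)
    generalize norm3 (x - circlePoint θ) = d at *
    have h2 := hb θ (t - d / c) (sub_le_self t (by positivity))
    rw [norm_smul, norm_div, Real.norm_eq_abs, Real.norm_of_nonneg (by positivity)]
    calc _ ≤ M / (1 * d ^ (n + 1)) * d := by gcongr
      _ = M / d ^ n := by rw [pow_succ]; field_simp

/-- The integral `∫ 1 / (a 𝔯ⁿ) J(θ, t_r) dθ`, with `J` tangential, decays like `r⁻ⁿ`. -/
theorem sphereDecay_tangential (hg : Continuous g) (hM : 0 ≤ M) (hc : 0 < c)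
    (hb : ∀ θ s, s ≤ t → |g (θ, s)| ≤ M) {a : ℝ} (ha : 1 ≤ a) (n : ℕ) :
    SphereDecay (fun x => ∫ θ in (-π)..π,
      (1 / (a * norm3 (x - circlePoint θ) ^ n)) •
        (g (θ, t - norm3 (x - circlePoint θ) / c) •
          ((-Real.sin θ, Real.cos θ, 0) : ℝ × ℝ × ℝ))) n := by
  have ha0 : 0 < a := by linarith
  refine sphereDecay_integral hM ?_ fun x θ hd => ?_
  · apply ContinuousOn.fun_smul
    · apply ContinuousOn.div
      · fun_prop
      · fun_prop
      · exact fun p hp => mul_ne_zero ha0.ne' (pow_ne_zero _ hp)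
    · fun_prop
  · generalize norm3 (x - circlePoint θ) = d at *
    have h2 := hb θ (t - d / c) (sub_le_self t (by positivity))
    rw [norm_smul, norm_smul, norm_div, norm_one, Real.norm_eq_abs (g _),
      Real.norm_of_nonneg (by positivity)]
    calc _ ≤ 1 / (1 * d ^ n) * (M * 1) := by
          gcongr
          exact norm_tangent_le θ
      _ = M / d ^ n := by field_simp

/-- The integral `∫ 1 / (a 𝔯ⁿ⁺¹) J(θ, t_r) × (x - γ(θ)) dθ`, with `J` tangential, decays like `r⁻ⁿ`. -/
theorem sphereDecay_tangential_cross (hg : Continuous g) (hM : 0 ≤ M) (hc : 0 < c)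
    (hb : ∀ θ s, s ≤ t → |g (θ, s)| ≤ M) {a : ℝ} (ha : 1 ≤ a) (n : ℕ) :
    SphereDecay (fun x => ∫ θ in (-π)..π,
      (1 / (a * norm3 (x - circlePoint θ) ^ (n + 1))) •
        cross3 (g (θ, t - norm3 (x - circlePoint θ) / c) •
          ((-Real.sin θ, Real.cos θ, 0) : ℝ × ℝ × ℝ)) (x - circlePoint θ)) n := by
  have ha0 : 0 < a := by linarith
  refine sphereDecay_integral (M := 2 * M) (by positivity) ?_ fun x θ hd => ?_
  · apply ContinuousOn.fun_smul
    · apply ContinuousOn.div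
      · fun_prop
      · fun_prop
      · exact fun p hp => mul_ne_zero ha0.ne' (pow_ne_zero _ hp)
    · refine (continuous_cross3.comp (Continuous.prodMk ?_ ?_)).continuousOn <;> fun_prop
  · have h1 := norm_le_norm3 (x - circlePoint θ)
    generalize norm3 (x - circlePoint θ) = d at *
    have h2 := hb θ (t - d / c) (sub_le_self t (by positivity))
    rw [norm_smul, norm_div, norm_one, Real.norm_of_nonneg (by positivity)]
    calc _ ≤ 1 / (1 * d ^ (n + 1)) * (2 * ((M * 1) * d)) := by
          gcongr
          refine (norm_cross3_le _ _).trans ?_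
          rw [norm_smul, Real.norm_eq_abs]
          gcongr
          exact norm_tangent_le θ
      _ = 2 * M / d ^ n := by rw [pow_succ]; field_simp

end Kernels

end

/-- for the causal Jefimenko fields of a charge/current distribution on the
unit circle, only the far-field terms `E₂×B₂ + E₃×B₂` contribute to the radiated power at
infinity: `P(r,t) - Q(r,t) → 0` as `r → ∞`. -/
theorem jefimenko_far_field_terms
    (ε₀ μ₀ c : ℝ) (hε₀ : 0 < ε₀) (hμ₀ : 0 < μ₀) (hc : 1 < c)
    (hc2 : c ^ 2 = 1 / (ε₀ * μ₀))
    (q j : ℝ × ℝ → ℝ)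
    (hq : ContDiff ℝ (⊤ : ℕ∞) q) (hj : ContDiff ℝ (⊤ : ℕ∞) j)
    (hperq : ∀ θ t : ℝ, q (θ + 2 * π, t) = q (θ, t))
    (hperj : ∀ θ t : ℝ, j (θ + 2 * π, t) = j (θ, t))
    (hbdd : ∀ t : ℝ, ∃ M : ℝ, ∀ θ s : ℝ, s ≤ t →
      |q (θ, s)| + |deriv (fun u => q (θ, u)) s|
        + |j (θ, s)| + |deriv (fun u => j (θ, u)) s| ≤ M) :
    let rc : ℝ → ℝ × ℝ × ℝ := fun θ => (Real.cos θ, Real.sin θ, 0)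
    let dtq : ℝ → ℝ → ℝ := fun θ s => deriv (fun u => q (θ, u)) s
    let Jbar : ℝ → ℝ → ℝ × ℝ × ℝ := fun θ s => j (θ, s) • (-Real.sin θ, Real.cos θ, 0)
    let dtJ : ℝ → ℝ → ℝ × ℝ × ℝ :=
      fun θ s => (deriv (fun u => j (θ, u)) s) • (-Real.sin θ, Real.cos θ, 0)
    let E₁ : ℝ × ℝ × ℝ → ℝ → ℝ × ℝ × ℝ := fun x t =>
      (1 / (4 * π * ε₀)) • ∫ θ in (-π)..π,
        (q (θ, t - norm3 (x - rc θ) / c) / norm3 (x - rc θ) ^ 3) • (x - rc θ)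
    let E₂ : ℝ × ℝ × ℝ → ℝ → ℝ × ℝ × ℝ := fun x t =>
      (1 / (4 * π * ε₀)) • ∫ θ in (-π)..π,
        (dtq θ (t - norm3 (x - rc θ) / c) / (c * norm3 (x - rc θ) ^ 2)) • (x - rc θ)
    let E₃ : ℝ × ℝ × ℝ → ℝ → ℝ × ℝ × ℝ := fun x t =>
      -((1 / (4 * π * ε₀)) • ∫ θ in (-π)..π,
        (1 / (c ^ 2 * norm3 (x - rc θ))) • dtJ θ (t - norm3 (x - rc θ) / c))
    let B₁ : ℝ × ℝ × ℝ → ℝ → ℝ × ℝ × ℝ := fun x t =>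
      (μ₀ / (4 * π)) • ∫ θ in (-π)..π,
        (1 / norm3 (x - rc θ) ^ 3) • cross3 (Jbar θ (t - norm3 (x - rc θ) / c)) (x - rc θ)
    let B₂ : ℝ × ℝ × ℝ → ℝ → ℝ × ℝ × ℝ := fun x t =>
      (μ₀ / (4 * π)) • ∫ θ in (-π)..π,
        (1 / (c * norm3 (x - rc θ) ^ 2)) • cross3 (dtJ θ (t - norm3 (x - rc θ) / c)) (x - rc θ)
    let E : ℝ × ℝ × ℝ → ℝ → ℝ × ℝ × ℝ := fun x t => E₁ x t + E₂ x t + E₃ x t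
    let B : ℝ × ℝ × ℝ → ℝ → ℝ × ℝ × ℝ := fun x t => B₁ x t + B₂ x t
    let P : ℝ → ℝ → ℝ := fun r t => sphereFlux (fun x => cross3 (E x t) (B x t)) r
    let Q : ℝ → ℝ → ℝ := fun r t =>
      sphereFlux (fun x => cross3 (E₂ x t) (B₂ x t) + cross3 (E₃ x t) (B₂ x t)) r
    ∀ t : ℝ, Tendsto (fun r => P r t - Q r t) atTop (𝓝 0) := by
  intro rc dtq Jbar dtJ E₁ E₂ E₃ B₁ B₂ E B P Q t
  obtain ⟨M, hM⟩ := hbdd t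
  have hc0 : 0 < c := by linarith
  have hM0 : 0 ≤ M := le_trans (by positivity) (hM 0 t le_rfl)
  have hq' := continuous_deriv_snd (hq.of_le (by exact_mod_cast le_top))
  have hj' := continuous_deriv_snd (hj.of_le (by exact_mod_cast le_top))
  have bq : ∀ θ s, s ≤ t → |q (θ, s)| ≤ M := fun θ s hs => by
    refine le_trans ?_ (hM θ s hs)
    rw [add_assoc, add_assoc]
    exact le_add_of_nonneg_right (by positivity)
  have bq' : ∀ θ s, s ≤ t → |deriv (fun u => q (θ, u)) s| ≤ M := fun θ s hs => by
    linarith [hM θ s hs, abs_nonneg (q (θ, s)), abs_nonneg (j (θ, s)),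
      abs_nonneg (deriv (fun u => j (θ, u)) s)]
  have bj : ∀ θ s, s ≤ t → |j (θ, s)| ≤ M := fun θ s hs => by
    linarith [hM θ s hs, abs_nonneg (q (θ, s)), abs_nonneg (deriv (fun u => q (θ, u)) s),
      abs_nonneg (deriv (fun u => j (θ, u)) s)]
  have bj' : ∀ θ s, s ≤ t → |deriv (fun u => j (θ, u)) s| ≤ M := fun θ s hs => by
    linarith [hM θ s hs, abs_nonneg (q (θ, s)), abs_nonneg (deriv (fun u => q (θ, u)) s),
      abs_nonneg (j (θ, s))]
  have hE₁ : SphereDecay (fun x => E₁ x t) 2 := by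
    have h := sphereDecay_radial hq.continuous hM0 hc0 bq le_rfl 2
    simp only [one_mul] at h
    exact h.const_smul _
  have hE₂ : SphereDecay (fun x => E₂ x t) 1 :=
    (sphereDecay_radial hq' hM0 hc0 bq' hc.le 1).const_smul _
  have hE₃ : SphereDecay (fun x => E₃ x t) 1 := by
    have h := sphereDecay_tangential hj' hM0 hc0 bj' (one_le_pow₀ hc.le : 1 ≤ c ^ 2) 1
    simp only [pow_one] at h
    exact (h.const_smul _).neg
  have hB₁ : SphereDecay (fun x => B₁ x t) 2 := by
    have h := sphereDecay_tangential_cross hj.continuous hM0 hc0 bj le_rfl 2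
    simp only [one_mul] at h
    exact h.const_smul _
  have hB₂ : SphereDecay (fun x => B₂ x t) 1 :=
    (sphereDecay_tangential_cross hj' hM0 hc0 bj' hc.le 1).const_smul _
  exact hE₁.tendsto_flux_cross_sub hE₂ hE₃ hB₁ hB₂
end

section
/- Let m be an even positive integer, c > 0 and r > 0. Define the vector fields Γ, Δ, Γ′, Δ′ : ℝ³ → ℝ³ by: Γ(p) = ∫_{-π}^{π} cos(mθ) cos( m(p₁cosθ + p₂sinθ)/√(r²+1) ) · p dθ, Δ(p) = ∫_{-π}^{π} sin(mθ) cos( m(p₁cosθ + p₂sinθ)/√(r²+1) ) · p dθ, Γ′(p) = ∫_{-π}^{π} sin(mθ) sin( m(p₁cosθ + p₂sinθ)/√(r²+1) ) · (p₃cosθ, p₃sinθ, −p₂sinθ − p₁cosθ) dθ, Δ′(p) = ∫_{-π}^{π} cos(mθ) sin( m(p₁cosθ + p₂sinθ)/√(r²+1) ) · (p₃cosθ, p₃sinθ, −p₂sinθ − p₁cosθ) dθ. Then the fluxes of all four cross-product fields Γ×Γ′, Γ×Δ′, Δ×Γ′ and Δ×Δ′ through the sphere S(r) of radius r centred at the origin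 are zero. -/
open Real Filter Topology

/-- A field whose first cross factor is radial is tangent to every centred sphere. -/
theorem sphereFlux_cross3_smul_self (g : ℝ × ℝ × ℝ → ℝ) (W : ℝ × ℝ × ℝ → ℝ × ℝ × ℝ) (r : ℝ) :
    sphereFlux (fun p => cross3 (g p • p) (W p)) r = 0 := by
  have tangent (a ρ x y z : ℝ) (w : ℝ × ℝ × ℝ) :
      dot3 (cross3 (a • (ρ * x, ρ * y, ρ * z)) w) (x, y, z) = 0 := by
    simp only [dot3, cross3, Prod.smul_mk, smul_eq_mul]
    ring
  simp only [sphereFlux, tangent, zero_mul, intervalIntegral.integral_zero]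

/-- for even positive `m`, the fluxes of `Γ×Γ′`, `Γ×Δ′`, `Δ×Γ′`, `Δ×Δ′`
through the sphere `S(r)` all vanish. -/
theorem angular_flux_integrals_vanish
    (m : ℕ) (hm : Even m) (hm0 : 0 < m) (c r : ℝ) (hc : 0 < c) (hr : 0 < r) :
    let Γ : ℝ × ℝ × ℝ → ℝ × ℝ × ℝ := fun p =>
      ∫ θ in (-π)..π,
        (Real.cos (m * θ) *
          Real.cos (m * (p.1 * Real.cos θ + p.2.1 * Real.sin θ) / Real.sqrt (r ^ 2 + 1))) • p
    let Δ : ℝ × ℝ × ℝ → ℝ × ℝ × ℝ := fun p =>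
      ∫ θ in (-π)..π,
        (Real.sin (m * θ) *
          Real.cos (m * (p.1 * Real.cos θ + p.2.1 * Real.sin θ) / Real.sqrt (r ^ 2 + 1))) • p
    let Γ' : ℝ × ℝ × ℝ → ℝ × ℝ × ℝ := fun p =>
      ∫ θ in (-π)..π,
        (Real.sin (m * θ) *
          Real.sin (m * (p.1 * Real.cos θ + p.2.1 * Real.sin θ) / Real.sqrt (r ^ 2 + 1))) •
          (p.2.2 * Real.cos θ, p.2.2 * Real.sin θ, -p.2.1 * Real.sin θ - p.1 * Real.cos θ)
    let Δ' : ℝ × ℝ × ℝ → ℝ × ℝ × ℝ := fun p =>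
      ∫ θ in (-π)..π,
        (Real.cos (m * θ) *
          Real.sin (m * (p.1 * Real.cos θ + p.2.1 * Real.sin θ) / Real.sqrt (r ^ 2 + 1))) •
          (p.2.2 * Real.cos θ, p.2.2 * Real.sin θ, -p.2.1 * Real.sin θ - p.1 * Real.cos θ)
    sphereFlux (fun p => cross3 (Γ p) (Γ' p)) r = 0 ∧
    sphereFlux (fun p => cross3 (Γ p) (Δ' p)) r = 0 ∧
    sphereFlux (fun p => cross3 (Δ p) (Γ' p)) r = 0 ∧
    sphereFlux (fun p => cross3 (Δ p) (Δ' p)) r = 0 := by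
  intro Γ Δ Γ' Δ'
  simp only [Γ, Δ, intervalIntegral.integral_smul_const]
  exact ⟨sphereFlux_cross3_smul_self _ Γ' r, sphereFlux_cross3_smul_self _ Δ' r,
    sphereFlux_cross3_smul_self _ Γ' r, sphereFlux_cross3_smul_self _ Δ' r⟩
end
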